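/- Let μ be a nonzero Radon measure on ℝ^d. Then μ is 1-flat, i.e. μ = c·H^1|_L for some affine line L ⊂ ℝ^d and some constant c > 0, if and only if Δ_μ(x,r) = 0 for every x ∈ supp μ and every r > 0. -/

import Mathlib

open MeasureTheory Metric
open scoped ENNReal NNReal

/-- `Δ_μ(x,r) = |μ(B(x,r))/r − μ(B(x,2r))/(2r)|`. -/
noncomputable def ballDelta {d : ℕ} (μ : Measure (EuclideanSpace ℝ (Fin d)))
    (x : EuclideanSpace ℝ (Fin d)) (r : ℝ) : ℝ :=
  |(μ (ball x r)).toReal / r - (μ (ball x (2 * r))).toReal / (2 * r)|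

/-- `L` is an affine line in `ℝ^d`. -/
def IsLine {d : ℕ} (L : Set (EuclideanSpace ℝ (Fin d))) : Prop :=
  ∃ x v : EuclideanSpace ℝ (Fin d), v ≠ 0 ∧ L = {y | ∃ t : ℝ, y = x + t • v}

/-- The support of a measure on a metric space: points all whose balls have
positive measure. -/
def msupport {X : Type*} [MeasurableSpace X] [PseudoMetricSpace X] (μ : Measure X) : Set X :=
  {x | ∀ r : ℝ, 0 < r → 0 < μ (ball x r)}

theorem oneD_core (N : ℝ → ℝ) (hN : Monotone N) (P : Set ℝ) (hne : P.Nonempty) (c C : ℝ)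
    (hc : 0 < c) (hC : 0 ≤ C)
    (hmeet : ∀ a b, a < b → N a < N b → ∃ s ∈ P, a ≤ s ∧ s < b)
    (hlow : ∀ s ∈ P, ∀ ρ : ℝ, 0 < ρ → c * ρ ≤ N (s + ρ) - N (s - ρ))
    (hup : ∀ s ∈ P, ∀ ρ : ℝ, 0 < ρ → N (s + ρ) - N (s - ρ) ≤ c * ρ + C / ρ) :
    ∀ a b, N b - N a = c / 2 * (b - a) := by
  obtain ⟨s0, hs0⟩ := hne
  -- a quantity C / R is small for large R
  have hsmall : ∀ η : ℝ, 0 < η → ∀ R : ℝ, C / η + 1 ≤ R → 0 < R ∧ C / R < η := by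
    intro η hη R hR
    have h1 : 0 ≤ C / η := by positivity
    have hR0 : 0 < R := by linarith
    refine ⟨hR0, ?_⟩
    rw [div_lt_iff₀ hR0]
    have : C = C / η * η := by field_simp
    nlinarith
  -- two distinct points
  have htwo : ∃ s ∈ P, ∃ s' ∈ P, s < s' := by
    by_contra hcon
    push Not at hcon
    have honly : ∀ s ∈ P, s = s0 := fun s hs => le_antisymm (hcon s0 hs0 s hs) (hcon s hs s0 hs0)
    have h1 := hup s0 hs0 1 one_pos
    have hρ : 0 < (1 + (C + 1) / c) := by positivity
    have h2 := hlow s0 hs0 (1 + (C + 1) / c) hρ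
    have hh : 0 < (C + 1) / c := by positivity
    have e : c * (1 + (C + 1) / c) = c + C + 1 := by field_simp; ring
    rw [e] at h2
    have hr : N (s0 + (1 + (C + 1) / c)) ≤ N (s0 + 1) := by
      by_contra hlt
      push Not at hlt
      obtain ⟨s, hs, h3, h4⟩ := hmeet _ _ (by linarith) hlt
      have := honly s hs
      linarith
    have hl : N (s0 - 1) ≤ N (s0 - (1 + (C + 1) / c)) := by
      by_contra hlt
      push Not at hlt
      obtain ⟨s, hs, h3, h4⟩ := hmeet _ _ (by linarith) hlt
      have := honly s hs
      linarith
    simp only [mul_one, div_one] at h1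
    linarith
  -- unbounded below
  have hbelow : ∀ B : ℝ, ∃ s ∈ P, s < B := by
    intro B
    by_contra hcon
    push Not at hcon
    obtain ⟨s, hs, s', hs', hlt⟩ := htwo
    have hconst : ∀ t t', t < t' → t' ≤ B → N t = N t' := by
      intro t t' htt ht'
      by_contra hne
      have := lt_of_le_of_ne (hN htt.le) hne
      obtain ⟨u, hu, h3, h4⟩ := hmeet _ _ htt this
      have := hcon u hu
      linarith
    set δ := s' - s with hδ
    have hδ0 : 0 < δ := by linarith
    set ρ := |C / (c * δ) + 1| + |s - B| + |s' - B| + δ with hρdef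
    have e1 := le_abs_self (C / (c * δ) + 1)
    have e2 := le_abs_self (s - B)
    have e3 := le_abs_self (s' - B)
    have e4 := abs_nonneg (C / (c * δ) + 1)
    have e5 := abs_nonneg (s - B)
    have e6 := abs_nonneg (s' - B)
    obtain ⟨h5, h6⟩ := hsmall (c * δ) (by positivity) (ρ - δ) (by linarith)
    have h7 := hlow s hs ρ (by linarith)
    have h8 := hup s' hs' (ρ - δ) h5
    have h9 : s' + (ρ - δ) = s + ρ := by rw [hδ]; ring
    rw [h9] at h8
    have h10 : N (s - ρ) = N (s' - (ρ - δ)) := hconst _ _ (by linarith) (by linarith)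
    nlinarith
  -- small gaps
  have hgap : ∀ η : ℝ, 0 < η → ∃ s ∈ P, ∃ s' ∈ P, s < s' ∧ s' - s ≤ 2 * η := by
    intro η hη
    obtain ⟨s, hs, hsB⟩ := hbelow (s0 - (C / (c * η) + 1) - η)
    have hq : 0 ≤ C / (c * η) := by positivity
    obtain ⟨hR, hR'⟩ := hsmall (c * η) (by positivity) (s0 - s) (by linarith)
    by_contra hcon
    push Not at hcon
    have h1 := hlow s hs (2 * η) (by linarith)
    have h2 : N s ≤ N (s - 2 * η) := by
      by_contra hlt
      push Not at hlt
      obtain ⟨u, hu, h3, h4⟩ := hmeet _ _ (by linarith) hlt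
      have := hcon u hu s hs h4
      linarith
    have h3 : N (s + 2 * η) ≤ N (s + η) := by
      by_contra hlt
      push Not at hlt
      obtain ⟨u, hu, h3, h4⟩ := hmeet _ _ (by linarith) hlt
      have := hcon s hs u hu (by linarith)
      linarith
    have h4 := hup s0 hs0 (s0 - s) hR
    have h5 := hlow s0 hs0 (s0 - s - η) (by linarith)
    have h6 : N (s0 + (s0 - s - η)) ≤ N (s0 + (s0 - s)) := hN (by linarith)
    have e1 : s0 - (s0 - s) = s := by ring
    have e2 : s0 - (s0 - s - η) = s + η := by ring
    rw [e1] at h4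
    rw [e2] at h5
    nlinarith
  -- density at infinity
  have hdens : ∀ η : ℝ, 0 < η → ∃ T, ∀ t, T ≤ t → ∃ s ∈ P, t ≤ s ∧ s < t + 4 * η := by
    intro η hη
    obtain ⟨s1, hs1, s2, hs2, hlt, hle⟩ := hgap η hη
    set δ := s2 - s1 with hδ
    have hδ0 : 0 < δ := by linarith
    have hq : 0 ≤ C / (c * δ) := by positivity
    refine ⟨s1 + (C / (c * δ) + 1), fun t ht => ?_⟩
    obtain ⟨hR, hR'⟩ := hsmall (c * δ) (by positivity) (t - s1) (by linarith)
    have h1 := hup s1 hs1 (t - s1) hR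
    have h2 := hlow s2 hs2 (t - s1 + δ) (by linarith)
    have e1 : s1 + (t - s1) = t := by ring
    have e2 : s2 + (t - s1 + δ) = t + 2 * δ := by rw [hδ]; ring
    have e3 : s2 - (t - s1 + δ) = s1 - (t - s1) := by rw [hδ]; ring
    rw [e1] at h1
    rw [e2, e3] at h2
    obtain ⟨s, hs, h3, h4⟩ := hmeet t (t + 2 * δ) (by linarith) (by nlinarith)
    exact ⟨s, hs, h3, by linarith⟩
  -- conclusion
  have hM : ∀ t1 t2, N t1 - c / 2 * t1 ≤ N t2 - c / 2 * t2 := by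
    intro t1 t2
    refine le_of_forall_pos_le_add fun ε hε => ?_
    set η := ε / (8 * c) with hηdef
    have hη : 0 < η := by positivity
    have hη' : c * η = ε / 8 := by rw [hηdef]; field_simp
    obtain ⟨T, hT⟩ := hdens η hη
    have hq : 0 ≤ C / (ε / 2) := by positivity
    obtain ⟨s', hs', hsB⟩ := hbelow (min t2 (s0 + t2) - (C / (ε / 2) + 1) - |t2| - |t1| - |T| - |s0| - 4 * η)
    have a1 := le_abs_self t2
    have a2 := neg_abs_le t2
    have a3 := le_abs_self t1
    have a4 := neg_abs_le t1
    have a5 := le_abs_self T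
    have a6 := le_abs_self s0
    have a7 := neg_abs_le s0
    have a8 := min_le_left t2 (s0 + t2)
    have a9 := min_le_right t2 (s0 + t2)
    have a10 := abs_nonneg T
    have h1 := hlow s' hs' (t2 - s') (by linarith)
    set ρ := s0 - (2 * s' - t2) with hρ
    obtain ⟨hR, hR'⟩ := hsmall (ε / 2) (by positivity) ρ (by linarith)
    have h2 := hup s0 hs0 ρ hR
    have e1 : s' + (t2 - s') = t2 := by ring
    have e2 : s' - (t2 - s') = s0 - ρ := by rw [hρ]; ring
    rw [e1, e2] at h1
    obtain ⟨s, hs, h3, h4⟩ := hT ((s0 + ρ + t1) / 2 - 4 * η) (by linarith)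
    have h5 := hlow s hs (s - t1) (by linarith)
    have e3 : s - (s - t1) = t1 := by ring
    rw [e3] at h5
    have h6 : N (s + (s - t1)) ≤ N (s0 + ρ) := hN (by linarith)
    have e4 : c * (t2 - s') = c * ρ / 2 - c/2 * s0 + c/2 * t2 := by rw [hρ]; ring
    have e5 : c * ((s0 + ρ + t1) / 2 - 4 * η) ≤ c * s := by nlinarith
    nlinarith
  intro a b
  have h1 := hM a b
  have h2 := hM b a
  linarith
section uniform
set_option linter.unusedSectionVars false
variable {E : Type*} [NormedAddCommGroup E] [InnerProductSpace ℝ E] [FiniteDimensional ℝ E]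
  [MeasurableSpace E] [BorelSpace E]

theorem ball_left_cont (μ : Measure E) (x : E) (r : ℝ) (M : ℝ≥0∞)
    (h : ∀ r' < r, μ (ball x r') ≤ M) : μ (ball x r) ≤ M := by
  obtain ⟨u, hu, hlt, hlim⟩ := exists_seq_strictMono_tendsto r
  have hU : ball x r = ⋃ n, ball x (u n) := by
    ext z
    simp only [mem_ball, Set.mem_iUnion]
    constructor
    · intro hz
      exact ((tendsto_order.1 hlim).1 _ hz).exists
    · rintro ⟨n, hn⟩
      exact hn.trans (hlt n)
  rw [hU]
  have hmono : Monotone (fun n => ball x (u n)) := fun m n hmn =>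
    ball_subset_ball (hu.monotone hmn)
  exact le_of_tendsto' (tendsto_measure_iUnion_atTop hmono) fun n => h _ (hlt n)

theorem ball_pow (μ : Measure E) (x : E)
    (h : ∀ r : ℝ, 0 < r → μ (ball x (2 * r)) = 2 * μ (ball x r)) (r : ℝ) (hr : 0 < r) (k : ℕ) :
    μ (ball x (2 ^ k * r)) = 2 ^ k * μ (ball x r) := by
  induction k with
  | zero => simp
  | succ k ih =>
    have : (2 : ℝ) ^ (k + 1) * r = 2 * (2 ^ k * r) := by ring
    rw [this, h _ (by positivity), ih, pow_succ]
    ring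

theorem ball_uniform (μ : Measure E) (x y : E)
    (hx : ∀ r : ℝ, 0 < r → μ (ball x (2 * r)) = 2 * μ (ball x r))
    (hy : ∀ r : ℝ, 0 < r → μ (ball y (2 * r)) = 2 * μ (ball y r)) (r : ℝ) :
    μ (ball x r) ≤ μ (ball y r) := by
  apply ball_left_cont
  intro r' hr'
  rcases le_or_gt r' 0 with h0 | h0
  · simp [ball_eq_empty.2 h0]
  obtain ⟨k, hk⟩ := pow_unbounded_of_one_lt (dist x y / (r - r')) (one_lt_two)
  have hsub : ball x (2 ^ k * r') ⊆ ball y (2 ^ k * r) := by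
    apply ball_subset_ball'
    rw [div_lt_iff₀ (by linarith)] at hk
    linarith
  have := measure_mono (μ := μ) hsub
  rw [ball_pow μ x hx r' h0, ball_pow μ y hy r (h0.trans hr')] at this
  exact (ENNReal.mul_le_mul_iff_right (by positivity) (by finiteness)).1 this

theorem map_radial_eq (μ : Measure E) [IsLocallyFiniteMeasure μ] (f g : E → ℝ) (hf : Measurable f)
    (hg : Measurable g) (C : ℝ≥0∞)
    (h : ∀ r, μ (f ⁻¹' (Set.Iio r)) = C * μ (g ⁻¹' (Set.Iio r)))
    (hfin : ∀ r, μ (f ⁻¹' (Set.Iio r)) ≠ ⊤) :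
    μ.map f = C • μ.map g := by
  refine Measure.ext_of_generateFrom_of_iUnion (Set.range Set.Iio) (fun n : ℕ => Set.Iio (n : ℝ))
    ?_ isPiSystem_Iio ?_ (fun i => ⟨_, rfl⟩) ?_ ?_
  · rw [← borel_eq_generateFrom_Iio]
    exact BorelSpace.measurable_eq
  · exact Set.eq_univ_of_forall fun x => Set.mem_iUnion.2 (exists_nat_gt x)
  · intro i
    rw [Measure.map_apply hf measurableSet_Iio]
    exact hfin _
  · rintro _ ⟨r, rfl⟩
    rw [Measure.map_apply hf measurableSet_Iio, Measure.smul_apply,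
      Measure.map_apply hg measurableSet_Iio, h, smul_eq_mul]

theorem integral_transl (μ : Measure E) [IsLocallyFiniteMeasure μ] (x : E)
    (h : ∀ r, μ (ball x r) = μ (ball 0 r)) (φ : ℝ → ℝ) (hφ : Measurable φ) :
    ∫ z, φ ‖z - x‖ ∂μ = ∫ z, φ ‖z‖ ∂μ := by
  have hb : ∀ r, (fun z : E => ‖z - x‖) ⁻¹' (Set.Iio r) = ball x r := by
    intro r; ext z; simp [dist_eq_norm]
  have hb0 : ∀ r, (fun z : E => ‖z‖) ⁻¹' (Set.Iio r) = ball 0 r := by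
    intro r; ext z; simp
  have hm : Measurable (fun z : E => ‖z - x‖) := by fun_prop
  have hm0 : Measurable (fun z : E => ‖z‖) := by fun_prop
  have := map_radial_eq μ (fun z => ‖z - x‖) (fun z => ‖z‖) hm hm0 1
    (by intro r; rw [hb, hb0, h, one_mul]) (by intro r; rw [hb]; exact measure_ball_lt_top.ne)
  rw [one_smul] at this
  rw [← integral_map (f := φ) hm.aemeasurable hφ.aestronglyMeasurable, this,
    integral_map hm0.aemeasurable hφ.aestronglyMeasurable]

theorem integral_scale (μ : Measure E) [IsLocallyFiniteMeasure μ]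
    (h : ∀ r : ℝ, 0 < r → μ (ball 0 (2 * r)) = 2 * μ (ball 0 r)) (φ : ℝ → ℝ) (hφ : Measurable φ) :
    ∫ z : E, φ (‖z‖ / 2) ∂μ = 2 * ∫ z, φ ‖z‖ ∂μ := by
  have hb : ∀ r, (fun z : E => ‖z‖ / 2) ⁻¹' (Set.Iio r) = ball 0 (2 * r) := by
    intro r; ext z
    simp only [Set.mem_preimage, Set.mem_Iio, mem_ball, dist_zero_right]
    constructor <;> intro h <;> linarith
  have hb0 : ∀ r, (fun z : E => ‖z‖) ⁻¹' (Set.Iio r) = ball 0 r := by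
    intro r; ext z; simp
  have hm : Measurable (fun z : E => ‖z‖ / 2) := by fun_prop
  have hm0 : Measurable (fun z : E => ‖z‖) := by fun_prop
  have := map_radial_eq μ (fun z => ‖z‖ / 2) (fun z => ‖z‖) hm hm0 2
    (by
      intro r; rw [hb, hb0]
      rcases le_or_gt r 0 with h0 | h0
      · rw [ball_eq_empty.2 h0, ball_eq_empty.2 (by linarith)]; simp
      · exact h r h0)
    (by intro r; rw [hb]; exact measure_ball_lt_top.ne)
  rw [← integral_map (f := φ) hm.aemeasurable hφ.aestronglyMeasurable, this,
    integral_smul_measure, integral_map hm0.aemeasurable hφ.aestronglyMeasurable]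
  simp
end uniform
section kernel
set_option linter.unusedSectionVars false
variable {E : Type*} [NormedAddCommGroup E] [InnerProductSpace ℝ E] [FiniteDimensional ℝ E]
  [MeasurableSpace E] [BorelSpace E]

/-- The truncated quadratic kernel. -/
noncomputable def ker (c : ℝ) (z : E) : ℝ := max (c - ‖z‖ ^ 2) 0

theorem ker_nonneg (c : ℝ) (z : E) : 0 ≤ ker c z := le_max_right _ _

@[fun_prop]
theorem ker_cont (c : ℝ) : Continuous (fun z : E => ker c z) := by
  unfold ker; fun_prop

theorem ker_zero (c : ℝ) (z : E) (h : c ≤ ‖z‖ ^ 2) : ker c z = 0 :=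
  max_eq_right (by linarith)

theorem ker_le (c : ℝ) (hc : 0 ≤ c) (z : E) : ker c z ≤ c :=
  max_le (by nlinarith [sq_nonneg ‖z‖]) hc

theorem ker_pos_norm (c : ℝ) (_hc : 0 ≤ c) (z : E) (h : ker c z ≠ 0) : ‖z‖ < √c := by
  by_contra hcon
  push Not at hcon
  apply h
  apply ker_zero
  exact (Real.sqrt_le_left (norm_nonneg z)).1 hcon

theorem ker_mul_norm (c : ℝ) (hc : 0 ≤ c) (z : E) : ker c z * ‖z‖ ≤ ker c z * √c := by
  by_cases h : ker c z = 0
  · simp [h]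
  · exact mul_le_mul_of_nonneg_left (ker_pos_norm c hc z h).le (ker_nonneg c z)

theorem integ_of_cont {G : Type*} [NormedAddCommGroup G] (μ : Measure E)
    [IsLocallyFiniteMeasure μ] (f : E → G) (hf : Continuous f) (R : ℝ)
    (h : ∀ z, R < ‖z‖ → f z = 0) : Integrable f μ := by
  apply hf.integrable_of_hasCompactSupport
  apply HasCompactSupport.intro (isCompact_closedBall 0 R)
  intro z hz
  apply h
  simpa using hz

theorem integ_ker {G : Type*} [NormedAddCommGroup G] [NormedSpace ℝ G] (μ : Measure E)
    [IsLocallyFiniteMeasure μ] (c : ℝ) (f : E → G) (hf : Continuous f) (n : ℕ) (hn : n ≠ 0) :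
    Integrable (fun z => ker c z ^ n • f z) μ := by
  apply integ_of_cont μ _ (by fun_prop) (√c)
  intro z hz
  rw [ker_zero, zero_pow hn, zero_smul]
  exact ((Real.sqrt_le_left (norm_nonneg z)).1 hz.le)

theorem integ_ker' (μ : Measure E) [IsLocallyFiniteMeasure μ] (c : ℝ) (f : E → ℝ)
    (hf : Continuous f) (n : ℕ) (hn : n ≠ 0) : Integrable (fun z => ker c z ^ n * f z) μ :=
  integ_ker μ c f hf n hn

theorem integ_ker1 (μ : Measure E) [IsLocallyFiniteMeasure μ] (c : ℝ) (f : E → ℝ)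
    (hf : Continuous f) : Integrable (fun z => ker c z * f z) μ := by
  simpa using integ_ker' μ c f hf 1 one_ne_zero

theorem integ_kerp (μ : Measure E) [IsLocallyFiniteMeasure μ] (c : ℝ) (n : ℕ) (hn : n ≠ 0) :
    Integrable (fun z => ker c z ^ n) μ := by
  simpa using integ_ker' μ c (fun _ => 1) continuous_const n hn

noncomputable def S1 (μ : Measure E) (c : ℝ) : ℝ := ∫ z, ker c z ∂μ
noncomputable def S2 (μ : Measure E) (c : ℝ) : ℝ := ∫ z, ker c z ^ 2 ∂μ

theorem integ_ker0 (μ : Measure E) [IsLocallyFiniteMeasure μ] (c : ℝ) :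
    Integrable (fun z => ker c z) μ := by
  simpa using integ_kerp μ c 1 one_ne_zero

theorem S1_nonneg (μ : Measure E) (c : ℝ) : 0 ≤ S1 μ c :=
  integral_nonneg fun z => ker_nonneg c z

theorem S2_pos (μ : Measure E) [IsLocallyFiniteMeasure μ] (h0 : ∀ r : ℝ, 0 < r → 0 < μ (ball 0 r))
    (c : ℝ) (hc : 0 < c) : 0 < S2 μ c := by
  unfold S2
  rw [integral_pos_iff_support_of_nonneg (fun z => by positivity) (integ_kerp μ c 2 two_ne_zero)]
  refine (h0 (√c) (Real.sqrt_pos.2 hc)).trans_le (measure_mono ?_)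
  intro z hz
  simp only [mem_ball, dist_zero_right] at hz
  have : ‖z‖ ^ 2 < c := (Real.lt_sqrt (norm_nonneg z)).1 hz
  have h2 : 0 < ker c z := lt_max_of_lt_left (by linarith)
  simp only [Function.mem_support]
  positivity

theorem ker_scale (c : ℝ) (z : E) : ker (4 * c) z = 4 * max (c - (‖z‖ / 2) ^ 2) 0 := by
  unfold ker
  rw [mul_max_of_nonneg _ _ (by norm_num : (0:ℝ) ≤ 4)]
  congr 1
  · ring
  · ring

theorem S1_scale (μ : Measure E) [IsLocallyFiniteMeasure μ]
    (h : ∀ r : ℝ, 0 < r → μ (ball 0 (2 * r)) = 2 * μ (ball 0 r)) (c : ℝ) :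
    S1 μ (4 * c) = 8 * S1 μ c := by
  have := integral_scale μ h (fun r => 4 * max (c - r ^ 2) 0) (by fun_prop)
  unfold S1
  simp only [ker_scale]
  rw [this, integral_const_mul]
  unfold ker
  ring

theorem S2_scale (μ : Measure E) [IsLocallyFiniteMeasure μ]
    (h : ∀ r : ℝ, 0 < r → μ (ball 0 (2 * r)) = 2 * μ (ball 0 r)) (c : ℝ) :
    S2 μ (4 * c) = 32 * S2 μ c := by
  have := integral_scale μ h (fun r => (4 * max (c - r ^ 2) 0) ^ 2) (by fun_prop)
  unfold S2
  simp only [ker_scale]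
  rw [this]
  simp only [mul_pow]
  rw [integral_const_mul]
  unfold ker
  ring

theorem S1_pow (μ : Measure E) [IsLocallyFiniteMeasure μ]
    (h : ∀ r : ℝ, 0 < r → μ (ball 0 (2 * r)) = 2 * μ (ball 0 r)) (c : ℝ) (k : ℕ) :
    S1 μ (4 ^ k * c) = 8 ^ k * S1 μ c := by
  induction k with
  | zero => simp
  | succ k ih =>
    have : (4 : ℝ) ^ (k + 1) * c = 4 * (4 ^ k * c) := by ring
    rw [this, S1_scale μ h, ih]; ring

theorem S2_pow (μ : Measure E) [IsLocallyFiniteMeasure μ]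
    (h : ∀ r : ℝ, 0 < r → μ (ball 0 (2 * r)) = 2 * μ (ball 0 r)) (c : ℝ) (k : ℕ) :
    S2 μ (4 ^ k * c) = 32 ^ k * S2 μ c := by
  induction k with
  | zero => simp
  | succ k ih =>
    have : (4 : ℝ) ^ (k + 1) * c = 4 * (4 ^ k * c) := by ring
    rw [this, S2_scale μ h, ih]; ring

/-- Second moment identity for the trace. -/
theorem ker_mul_sq (c : ℝ) (z : E) : ker c z * ‖z‖ ^ 2 = c * ker c z - ker c z ^ 2 := by
  unfold ker
  rcases le_total (c - ‖z‖ ^ 2) 0 with h | h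
  · rw [max_eq_right h]; ring
  · rw [max_eq_left h]; ring

theorem int_ker_sq (μ : Measure E) [IsLocallyFiniteMeasure μ] (c : ℝ) :
    ∫ z, ker c z * ‖z‖ ^ 2 ∂μ = c * S1 μ c - S2 μ c := by
  simp only [ker_mul_sq]
  rw [integral_sub ((integ_ker0 μ c).const_mul c) (integ_kerp μ c 2 two_ne_zero),
    integral_const_mul]
  rfl

theorem cubic_ineq (u h : ℝ) :
    |max (u - h) 0 ^ 3 - max u 0 ^ 3 + 3 * max u 0 ^ 2 * h - 3 * max u 0 * h ^ 2| ≤ 7 * |h| ^ 3 := by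
  have hh : 0 ≤ |h| ^ 3 := by positivity
  rcases le_total u 0 with hu | hu <;> rcases le_total (u - h) 0 with hv | hv
  · rw [max_eq_right hu, max_eq_right hv]; norm_num
  · rw [max_eq_right hu, max_eq_left hv]
    have h0 : h ≤ 0 := by linarith
    have h1 : |u - h| ≤ |h| := by rw [abs_of_nonneg hv, abs_of_nonpos h0]; linarith
    have h2 := pow_le_pow_left₀ (abs_nonneg _) h1 3
    simp only [ne_eq, OfNat.ofNat_ne_zero, not_false_eq_true, zero_pow, sub_zero, mul_zero, zero_mul,
      add_zero, abs_pow]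
    linarith
  · rw [max_eq_left hu, max_eq_right hv]
    have h0 : 0 ≤ h := by linarith
    rw [abs_of_nonneg h0]
    have a1 : u ^ 3 ≤ h ^ 3 := pow_le_pow_left₀ hu (by linarith) 3
    have a2 : u ^ 2 * h ≤ h ^ 2 * h :=
      mul_le_mul_of_nonneg_right (pow_le_pow_left₀ hu (by linarith) 2) h0
    have a3 : u * h ^ 2 ≤ h * h ^ 2 := mul_le_mul_of_nonneg_right (by linarith) (by positivity)
    have a4 : 0 ≤ u ^ 3 := by positivity
    have a5 : 0 ≤ u ^ 2 * h := by positivity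
    have a6 : 0 ≤ u * h ^ 2 := by positivity
    rw [abs_le]
    constructor <;> nlinarith
  · rw [max_eq_left hu, max_eq_left hv]
    have : (u - h) ^ 3 - u ^ 3 + 3 * u ^ 2 * h - 3 * u * h ^ 2 = - h ^ 3 := by ring
    rw [this, abs_neg, abs_pow]
    linarith

/-- The basic expansion at one scale. -/
theorem expansion (μ : Measure E) [IsLocallyFiniteMeasure μ] (x : E)
    (hx : ∀ r, μ (ball x r) = μ (ball 0 r)) (c : ℝ) (hc : 0 < c) :
    |S2 μ c * ‖x‖ ^ 2 - 2 * inner ℝ x (∫ z, ker c z ^ 2 • z ∂μ)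
      - 4 * ∫ z, ker c z * inner ℝ x z ^ 2 ∂μ| ≤
    7 * (‖x‖ * (3 * ‖x‖ + 2 * √c)) ^ 3 * μ.real (ball 0 (√c + ‖x‖))
      + S1 μ c * (‖x‖ ^ 4 + 4 * ‖x‖ ^ 3 * √c) := by
  have hsc : 0 ≤ √c := Real.sqrt_nonneg c
  have hnx : 0 ≤ ‖x‖ := norm_nonneg x
  have hexp : ∀ z : E, ‖z - x‖ ^ 2 = ‖z‖ ^ 2 + (‖x‖ ^ 2 - 2 * inner ℝ x z) := by
    intro z
    rw [norm_sub_sq_real, real_inner_comm]; ring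
  have hI0 : ∫ z, (ker c (z - x) ^ 3 - ker c z ^ 3) ∂μ = 0 := by
    have h1 := integral_transl μ x hx (fun r => max (c - r ^ 2) 0 ^ 3) (by fun_prop)
    rw [integral_sub _ (integ_kerp μ c 3 (by norm_num))]
    · unfold ker
      rw [h1, sub_self]
    · apply integ_of_cont μ _ _ (√c + ‖x‖)
      · intro z hz
        rw [ker_zero, zero_pow (by norm_num)]
        have : √c ≤ ‖z - x‖ := by
          have := norm_sub_norm_le z x
          linarith
        exact (Real.sqrt_le_left (norm_nonneg _)).1 this
      · exact ((ker_cont c).comp (continuous_id.sub continuous_const)).pow 3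
  set h : E → ℝ := fun z => ‖x‖ ^ 2 - 2 * inner ℝ x z with hh
  have hhc : Continuous h := by rw [hh]; fun_prop
  have hker : ∀ z, ker c (z - x) = max ((c - ‖z‖ ^ 2) - h z) 0 := by
    intro z; unfold ker; rw [hexp]; congr 1; ring
  -- remainder
  set Rm : E → ℝ := fun z => ker c (z - x) ^ 3 - ker c z ^ 3 + 3 * ker c z ^ 2 * h z
    - 3 * ker c z * h z ^ 2 with hRm
  have hRb : ∀ z, ‖Rm z‖ ≤ (ball (0 : E) (√c + ‖x‖)).indicator
      (fun _ => 7 * (‖x‖ * (3 * ‖x‖ + 2 * √c)) ^ 3) z := by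
    intro z
    by_cases hz : z ∈ ball (0 : E) (√c + ‖x‖)
    · rw [Set.indicator_of_mem hz, Real.norm_eq_abs]
      have h1 : |Rm z| ≤ 7 * |h z| ^ 3 := by
        rw [hRm]
        simp only [hker]
        exact cubic_ineq _ _
      refine h1.trans ?_
      have h2 : |h z| ≤ ‖x‖ * (3 * ‖x‖ + 2 * √c) := by
        rw [mem_ball, dist_zero_right] at hz
        have h3 := abs_real_inner_le_norm x z
        have h4 : ‖x‖ * ‖z‖ ≤ ‖x‖ * (√c + ‖x‖) := mul_le_mul_of_nonneg_left hz.le hnx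
        rw [hh]
        rw [abs_le] at h3 ⊢
        constructor <;> nlinarith
      gcongr
    · rw [Set.indicator_of_notMem hz]
      rw [mem_ball, dist_zero_right, not_lt] at hz
      have h1 : ker c z = 0 := ker_zero _ _ ((Real.sqrt_le_left (norm_nonneg _)).1 (by linarith))
      have h2 : ker c (z - x) = 0 := by
        have := norm_sub_norm_le z x
        exact ker_zero _ _ ((Real.sqrt_le_left (norm_nonneg _)).1 (by linarith))
      rw [hRm]
      simp [h1, h2]
  have hRI : |∫ z, Rm z ∂μ| ≤ 7 * (‖x‖ * (3 * ‖x‖ + 2 * √c)) ^ 3 * μ.real (ball 0 (√c + ‖x‖)) := by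
    have hIndInt : Integrable ((ball (0 : E) (√c + ‖x‖)).indicator
      (fun _ => 7 * (‖x‖ * (3 * ‖x‖ + 2 * √c)) ^ 3)) μ :=
      (integrable_indicator_iff measurableSet_ball).2
        (integrableOn_const (measure_ball_lt_top.ne))
    have := norm_integral_le_of_norm_le hIndInt (Filter.Eventually.of_forall hRb)
    rw [integral_indicator measurableSet_ball, setIntegral_const, smul_eq_mul] at this
    rw [← Real.norm_eq_abs]
    linarith
  -- compute the integral of the remainder
  have i1 : Integrable (fun z => ker c (z - x) ^ 3 - ker c z ^ 3) μ := by
    apply integ_of_cont μ _ _ (√c + ‖x‖)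
    · intro z hz
      have h1 : ker c z = 0 := ker_zero _ _ ((Real.sqrt_le_left (norm_nonneg _)).1 (by linarith))
      have h2 : ker c (z - x) = 0 := by
        have := norm_sub_norm_le z x
        exact ker_zero _ _ ((Real.sqrt_le_left (norm_nonneg _)).1 (by linarith))
      simp [h1, h2]
    · exact (((ker_cont c).comp (continuous_id.sub continuous_const)).pow 3).sub ((ker_cont c).pow 3)
  have i2 : Integrable (fun z => ker c z ^ 2 * h z) μ := integ_ker' μ c h hhc 2 two_ne_zero
  have i3 : Integrable (fun z => ker c z * h z ^ 2) μ := integ_ker1 μ c _ (hhc.pow 2)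
  have hR : ∫ z, Rm z ∂μ = 3 * ∫ z, ker c z ^ 2 * h z ∂μ - 3 * ∫ z, ker c z * h z ^ 2 ∂μ := by
    have : Rm = fun z => (ker c (z - x) ^ 3 - ker c z ^ 3) + 3 * (ker c z ^ 2 * h z)
        - 3 * (ker c z * h z ^ 2) := by
      rw [hRm]; funext z; ring
    have i12 : Integrable (fun z => (ker c (z - x) ^ 3 - ker c z ^ 3) + 3 * (ker c z ^ 2 * h z)) μ :=
      i1.add (i2.const_mul 3)
    rw [this]
    beta_reduce
    rw [integral_sub i12 (i3.const_mul 3), integral_add i1 (i2.const_mul 3),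
      hI0, integral_const_mul, integral_const_mul, zero_add]
  have hA : ∫ z, ker c z ^ 2 * h z ∂μ
      = S2 μ c * ‖x‖ ^ 2 - 2 * inner ℝ x (∫ z, ker c z ^ 2 • z ∂μ) := by
    rw [← integral_inner (integ_ker μ c (fun z => z) continuous_id 2 two_ne_zero)]
    have : (fun z => ker c z ^ 2 * h z) = fun z => ‖x‖ ^ 2 * ker c z ^ 2
        - 2 * inner ℝ x (ker c z ^ 2 • z) := by
      funext z; rw [hh, inner_smul_right]; ring
    rw [this, integral_sub ((integ_kerp μ c 2 two_ne_zero).const_mul _), integral_const_mul,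
      integral_const_mul]
    · unfold S2; ring
    · simp only [inner_smul_right]
      exact (integ_ker' μ c (fun z => inner ℝ x z) (by fun_prop) 2 two_ne_zero).const_mul 2
  have i4 : Integrable (fun z => ker c z * inner ℝ x z ^ 2) μ :=
    integ_ker1 μ c _ (by fun_prop)
  have i5 : Integrable (fun z => ker c z * (‖x‖ ^ 4 - 4 * ‖x‖ ^ 2 * inner ℝ x z)) μ :=
    integ_ker1 μ c _ (by fun_prop)
  have hB : ∫ z, ker c z * h z ^ 2 ∂μ = (∫ z, ker c z * (‖x‖ ^ 4 - 4 * ‖x‖ ^ 2 * inner ℝ x z) ∂μ)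
      + 4 * ∫ z, ker c z * inner ℝ x z ^ 2 ∂μ := by
    rw [← integral_const_mul, ← integral_add i5 (i4.const_mul 4)]
    congr 1
    funext z
    rw [hh]; ring
  have hC : |∫ z, ker c z * (‖x‖ ^ 4 - 4 * ‖x‖ ^ 2 * inner ℝ x z) ∂μ|
      ≤ S1 μ c * (‖x‖ ^ 4 + 4 * ‖x‖ ^ 3 * √c) := by
    have := norm_integral_le_of_norm_le (f := fun z => ker c z * (‖x‖ ^ 4 - 4 * ‖x‖ ^ 2 * inner ℝ x z))
      ((integ_ker0 μ c).mul_const (‖x‖ ^ 4 + 4 * ‖x‖ ^ 3 * √c))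
      (Filter.Eventually.of_forall (fun z => ?_))
    · rw [integral_mul_const] at this
      exact this
    · rw [norm_mul, Real.norm_eq_abs, abs_of_nonneg (ker_nonneg c z), Real.norm_eq_abs]
      by_cases hz : ker c z = 0
      · simp [hz]
      · apply mul_le_mul_of_nonneg_left _ (ker_nonneg c z)
        have h1 := (ker_pos_norm c hc.le z hz).le
        have h3 := abs_real_inner_le_norm x z
        have h4 : ‖x‖ * ‖z‖ ≤ ‖x‖ * √c := mul_le_mul_of_nonneg_left h1 hnx
        have h5 : ‖x‖ ^ 2 * |inner ℝ x z| ≤ ‖x‖ ^ 2 * (‖x‖ * √c) :=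
          mul_le_mul_of_nonneg_left (h3.trans h4) (by positivity)
        refine (abs_sub _ _).trans ?_
        rw [abs_mul, abs_of_nonneg (by positivity : 0 ≤ ‖x‖ ^ 4),
          abs_of_nonneg (by positivity : 0 ≤ 4 * ‖x‖ ^ 2)]
        nlinarith
  rw [hR, hA, hB] at hRI
  have hS : 0 ≤ 7 * (‖x‖ * (3 * ‖x‖ + 2 * √c)) ^ 3 * μ.real (ball 0 (√c + ‖x‖)) := by positivity
  rw [abs_le] at hRI hC ⊢
  constructor <;> linarith [hRI.1, hRI.2, hC.1, hC.2]
end kernel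
section main
set_option linter.unusedSectionVars false
variable {E : Type*} [NormedAddCommGroup E] [InnerProductSpace ℝ E] [FiniteDimensional ℝ E]
  [MeasurableSpace E] [BorelSpace E]

theorem bounded_proj (V : ℕ → E) (F : Set E) (h : ∀ x ∈ F, ∃ C, ∀ k, |inner ℝ x (V k)| ≤ C) :
    ∃ (V' : ℕ → E) (C : ℝ), (∀ k, ‖V' k‖ ≤ C) ∧ ∀ x ∈ F, ∀ k, inner ℝ x (V' k) = inner ℝ x (V k) := by
  set W := Submodule.span ℝ F with hW
  have hb : ∀ x ∈ W, ∃ C, ∀ k, |inner ℝ x (V k)| ≤ C := by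
    intro x hx
    induction hx using Submodule.span_induction with
    | mem x hx => exact h x hx
    | zero => exact ⟨0, by simp⟩
    | add x y _ _ hx hy =>
      obtain ⟨C, hC⟩ := hx
      obtain ⟨D, hD⟩ := hy
      refine ⟨C + D, fun k => ?_⟩
      rw [inner_add_left]
      exact (abs_add_le _ _).trans (add_le_add (hC k) (hD k))
    | smul a x _ hx =>
      obtain ⟨C, hC⟩ := hx
      refine ⟨|a| * C, fun k => ?_⟩
      rw [real_inner_smul_left, abs_mul]
      exact mul_le_mul_of_nonneg_left (hC k) (abs_nonneg a)
  have hbs := banach_steinhaus (g := fun k => (innerSL ℝ (V k)).comp W.subtypeL) (by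
    rintro ⟨x, hx⟩
    obtain ⟨C, hC⟩ := hb x hx
    refine ⟨C, fun k => ?_⟩
    have := hC k
    rw [real_inner_comm] at this
    simpa using this)
  obtain ⟨C, hC⟩ := hbs
  have hpr : ∀ x ∈ W, ∀ k, inner ℝ x (W.starProjection (V k)) = inner ℝ x (V k) := by
    intro x hx k
    have := Submodule.starProjection_inner_eq_zero (K := W) (V k) x hx
    rw [inner_sub_left, real_inner_comm, real_inner_comm x] at this
    linarith
  refine ⟨fun k => W.starProjection (V k), C, fun k => ?_, fun x hx k => hpr x (Submodule.subset_span hx) k⟩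
  set w := W.starProjection (V k) with hw
  have hwW : w ∈ W := Submodule.starProjection_apply_mem W (V k)
  have h1 : inner ℝ w w = inner ℝ w (V k) := hpr w hwW k
  have h2 : |inner ℝ (V k) w| ≤ C * ‖w‖ := by
    have := ((innerSL ℝ (V k)).comp W.subtypeL).le_of_opNorm_le (hC k) ⟨w, hwW⟩
    simpa using this
  rw [real_inner_self_eq_norm_sq, real_inner_comm] at h1
  rcases (norm_nonneg w).eq_or_lt with h0 | h0
  · rw [← h0]; exact (norm_nonneg _).trans (hC k)
  · have := (le_abs_self _).trans h2
    rw [← h1] at this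
    nlinarith

/-- Normalised second moments. -/
noncomputable def Bf (μ : Measure E) (c : ℝ) (x y : E) : ℝ :=
  4 / S2 μ c * ∫ z, ker c z * (inner ℝ x z * inner ℝ y z) ∂μ

/-- Normalised first moment. -/
noncomputable def Vf (μ : Measure E) (c : ℝ) : E := (2 / S2 μ c) • ∫ z, ker c z ^ 2 • z ∂μ

noncomputable def tauf (μ : Measure E) (c : ℝ) : ℝ := 4 / S2 μ c * (c * S1 μ c - S2 μ c)

theorem sqrt_four_pow (c : ℝ) (k : ℕ) : √(4 ^ k * c) = 2 ^ k * √c := by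
  rw [Real.sqrt_mul (by positivity)]
  congr 1
  rw [show (4 : ℝ) ^ k = (2 ^ k) ^ 2 by rw [← pow_mul, mul_comm, pow_mul]; norm_num]
  exact Real.sqrt_sq (by positivity)

theorem expansion_seq (μ : Measure E) [IsLocallyFiniteMeasure μ]
    (h0 : ∀ r : ℝ, 0 < r → 0 < μ (ball 0 r))
    (hd : ∀ r : ℝ, 0 < r → μ (ball 0 (2 * r)) = 2 * μ (ball 0 r))
    (x : E) (hx : ∀ r, μ (ball x r) = μ (ball 0 r)) (c : ℝ) (hc : 0 < c) :
    ∃ K, ∀ k : ℕ, |‖x‖ ^ 2 - inner ℝ x (Vf μ (4 ^ k * c)) - Bf μ (4 ^ k * c) x x| ≤ K * (1 / 2) ^ k := by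
  set ρ := √c with hρ
  have hρ0 : 0 < ρ := Real.sqrt_pos.2 hc
  set G := μ.real (ball (0 : E) (ρ + ‖x‖)) with hG
  have hG0 : 0 ≤ G := measureReal_nonneg
  set K' := 7 * (‖x‖ * (3 * ‖x‖ + 2 * ρ)) ^ 3 * G + S1 μ c * (‖x‖ ^ 4 + 4 * ‖x‖ ^ 3 * ρ) with hK'
  refine ⟨K' / S2 μ c, fun k => ?_⟩
  have hck : 0 < 4 ^ k * c := by positivity
  have hS := S2_pos μ h0 c hc
  have hSk := S2_pos μ h0 _ hck
  have hex := expansion μ x hx (4 ^ k * c) hck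
  have hS1 := S1_nonneg μ c
  have h2k : (1 : ℝ) ≤ 2 ^ k := one_le_pow₀ (by norm_num)
  have hnx := norm_nonneg x
  have hg : μ.real (ball (0 : E) (2 ^ k * ρ + ‖x‖)) ≤ 2 ^ k * G := by
    have h1 : μ.real (ball (0 : E) (2 ^ k * (ρ + ‖x‖))) = 2 ^ k * G := by
      rw [measureReal_def, ball_pow μ 0 hd _ (by positivity) k, hG, measureReal_def]
      simp
    rw [← h1]
    apply measureReal_mono (ball_subset_ball _) measure_ball_lt_top.ne
    nlinarith
  have hbound : 7 * (‖x‖ * (3 * ‖x‖ + 2 * √(4 ^ k * c))) ^ 3 * μ.real (ball 0 (√(4 ^ k * c) + ‖x‖))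
      + S1 μ (4 ^ k * c) * (‖x‖ ^ 4 + 4 * ‖x‖ ^ 3 * √(4 ^ k * c)) ≤ 16 ^ k * K' := by
    rw [sqrt_four_pow, S1_pow μ hd]
    have a1 : ‖x‖ * (3 * ‖x‖ + 2 * (2 ^ k * ρ)) ≤ 2 ^ k * (‖x‖ * (3 * ‖x‖ + 2 * ρ)) := by
      have : 3 * ‖x‖ + 2 * (2 ^ k * ρ) ≤ 2 ^ k * (3 * ‖x‖ + 2 * ρ) := by nlinarith
      calc _ ≤ ‖x‖ * (2 ^ k * (3 * ‖x‖ + 2 * ρ)) := mul_le_mul_of_nonneg_left this hnx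
        _ = _ := by ring
    have a2 : (‖x‖ * (3 * ‖x‖ + 2 * (2 ^ k * ρ))) ^ 3 ≤ (2 ^ k * (‖x‖ * (3 * ‖x‖ + 2 * ρ))) ^ 3 :=
      pow_le_pow_left₀ (by positivity) a1 3
    have a3 : ‖x‖ ^ 4 + 4 * ‖x‖ ^ 3 * (2 ^ k * ρ) ≤ 2 ^ k * (‖x‖ ^ 4 + 4 * ‖x‖ ^ 3 * ρ) := by
      have : 0 ≤ ‖x‖ ^ 4 := by positivity
      nlinarith
    have e16 : (16 : ℝ) ^ k = (2 ^ k) ^ 4 := by rw [← pow_mul, mul_comm, pow_mul]; norm_num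
    have e8 : (8 : ℝ) ^ k = (2 ^ k) ^ 3 := by rw [← pow_mul, mul_comm, pow_mul]; norm_num
    calc _ ≤ 7 * (2 ^ k * (‖x‖ * (3 * ‖x‖ + 2 * ρ))) ^ 3 * (2 ^ k * G)
        + (8 ^ k * S1 μ c) * (2 ^ k * (‖x‖ ^ 4 + 4 * ‖x‖ ^ 3 * ρ)) := by gcongr
      _ = 16 ^ k * K' := by rw [hK', e16, e8]; ring
  have heq : ‖x‖ ^ 2 - inner ℝ x (Vf μ (4 ^ k * c)) - Bf μ (4 ^ k * c) x x
      = (S2 μ (4 ^ k * c) * ‖x‖ ^ 2 - 2 * inner ℝ x (∫ z, ker (4 ^ k * c) z ^ 2 • z ∂μ)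
      - 4 * ∫ z, ker (4 ^ k * c) z * inner ℝ x z ^ 2 ∂μ) / S2 μ (4 ^ k * c) := by
    unfold Vf Bf
    rw [real_inner_smul_right]
    simp only [← sq]
    field_simp
  rw [heq, abs_div, abs_of_pos hSk, div_le_iff₀ hSk]
  refine hex.trans (hbound.trans (le_of_eq ?_))
  rw [S2_pow μ hd]
  have e32 : (32 : ℝ) ^ k = 16 ^ k * 2 ^ k := by rw [← mul_pow]; norm_num
  rw [e32, one_div, inv_pow]
  field_simp

theorem tauf_scale (μ : Measure E) [IsLocallyFiniteMeasure μ]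
    (hd : ∀ r : ℝ, 0 < r → μ (ball 0 (2 * r)) = 2 * μ (ball 0 r)) (c : ℝ) (k : ℕ) :
    tauf μ (4 ^ k * c) = tauf μ c := by
  unfold tauf
  rw [S1_pow μ hd, S2_pow μ hd]
  have e32 : (32 : ℝ) ^ k = 4 ^ k * 8 ^ k := by rw [← mul_pow]; norm_num
  rw [e32]
  have : c * S1 μ c - S2 μ c = (4 ^ k * c * (8 ^ k * S1 μ c) - 4 ^ k * 8 ^ k * S2 μ c) / (4 ^ k * 8 ^ k) := by
    field_simp
  rw [this]
  ring

theorem Bf_diag_nonneg (μ : Measure E) [IsLocallyFiniteMeasure μ] (c : ℝ) (hS : 0 < S2 μ c)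
    (x : E) : 0 ≤ Bf μ c x x := by
  unfold Bf
  apply mul_nonneg (by positivity)
  exact integral_nonneg fun z => mul_nonneg (ker_nonneg c z) (mul_self_nonneg _)

theorem Bf_bound (μ : Measure E) [IsLocallyFiniteMeasure μ] (c : ℝ) (hS : 0 < S2 μ c)
    (x y : E) : |Bf μ c x y| ≤ tauf μ c * (‖x‖ * ‖y‖) := by
  unfold Bf tauf
  rw [abs_mul, abs_of_pos (by positivity), mul_assoc]
  apply mul_le_mul_of_nonneg_left _ (by positivity)
  rw [← int_ker_sq, ← integral_mul_const]
  rw [← Real.norm_eq_abs]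
  apply norm_integral_le_of_norm_le
    ((integ_ker1 μ c (fun z => ‖z‖ ^ 2) (by fun_prop)).mul_const (‖x‖ * ‖y‖))
  refine Filter.Eventually.of_forall fun z => ?_
  rw [norm_mul, Real.norm_eq_abs, abs_of_nonneg (ker_nonneg c z), norm_mul, mul_assoc]
  apply mul_le_mul_of_nonneg_left _ (ker_nonneg c z)
  have h1 := abs_real_inner_le_norm x z
  have h2 := abs_real_inner_le_norm y z
  calc _ ≤ (‖x‖ * ‖z‖) * (‖y‖ * ‖z‖) := by
        apply mul_le_mul h1 h2 (abs_nonneg _) (by positivity)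
    _ = _ := by ring

theorem Bf_symm (μ : Measure E) (c : ℝ) (x y : E) : Bf μ c x y = Bf μ c y x := by
  unfold Bf; simp only [mul_comm]

theorem int_quad {ι : Type*} [Fintype ι] (b : OrthonormalBasis ι ℝ E) (μ : Measure E)
    [IsLocallyFiniteMeasure μ] (c : ℝ) (q : ι → ι → ℝ) :
    4 / S2 μ c * ∫ z, ker c z * (∑ i, ∑ j, q i j * (inner ℝ (b i) z * inner ℝ (b j) z)) ∂μ
      = ∑ i, ∑ j, q i j * Bf μ c (b i) (b j) := by
  have hI : ∀ i j, Integrable (fun z => q i j * (ker c z * (inner ℝ (b i) z * inner ℝ (b j) z))) μ :=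
    fun i j => (integ_ker1 μ c _ (by fun_prop)).const_mul _
  have : ∀ z, ker c z * (∑ i, ∑ j, q i j * (inner ℝ (b i) z * inner ℝ (b j) z))
      = ∑ i, ∑ j, q i j * (ker c z * (inner ℝ (b i) z * inner ℝ (b j) z)) := by
    intro z
    rw [Finset.mul_sum]
    refine Finset.sum_congr rfl fun i _ => ?_
    rw [Finset.mul_sum]
    refine Finset.sum_congr rfl fun j _ => ?_
    ring
  simp only [this]
  rw [integral_finsetSum _ (fun i _ => integrable_finsetSum _ (fun j _ => hI i j)), Finset.mul_sum]
  refine Finset.sum_congr rfl fun i _ => ?_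
  rw [integral_finsetSum _ (fun j _ => hI i j), Finset.mul_sum]
  refine Finset.sum_congr rfl fun j _ => ?_
  rw [integral_const_mul]
  unfold Bf
  ring

theorem Bf_expand {ι : Type*} [Fintype ι] (b : OrthonormalBasis ι ℝ E) (μ : Measure E)
    [IsLocallyFiniteMeasure μ] (c : ℝ) (x : E) :
    Bf μ c x x = ∑ i, ∑ j, (inner ℝ (b i) x * inner ℝ (b j) x) * Bf μ c (b i) (b j) := by
  rw [← int_quad]
  unfold Bf
  congr 2
  funext z
  congr 1
  have h1 := b.sum_inner_mul_inner x z
  rw [← h1, Finset.sum_mul_sum]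
  refine Finset.sum_congr rfl fun i _ => Finset.sum_congr rfl fun j _ => ?_
  rw [real_inner_comm x (b i), real_inner_comm x (b j)]
  ring

theorem Bf_trace {ι : Type*} [Fintype ι] (b : OrthonormalBasis ι ℝ E) (μ : Measure E)
    [IsLocallyFiniteMeasure μ] (c : ℝ) : ∑ i, Bf μ c (b i) (b i) = tauf μ c := by
  classical
  have := int_quad b μ c (fun i j => if i = j then 1 else 0)
  simp only [ite_mul, one_mul, zero_mul, Finset.sum_ite_eq, Finset.mem_univ, if_true] at this
  rw [← this]
  unfold tauf
  rw [← int_ker_sq]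
  congr 2
  funext z
  congr 1
  rw [← b.sum_sq_norm_inner_right]
  refine Finset.sum_congr rfl fun i _ => ?_
  rw [Real.norm_eq_abs, sq_abs, sq]

theorem main_limit {ι : Type*} [Fintype ι] (b : OrthonormalBasis ι ℝ E) (μ : Measure E)
    [IsLocallyFiniteMeasure μ]
    (h0 : ∀ r : ℝ, 0 < r → 0 < μ (ball 0 r))
    (hd : ∀ r : ℝ, 0 < r → μ (ball 0 (2 * r)) = 2 * μ (ball 0 r))
    (F : Set E) (hF : ∀ x ∈ F, ∀ r, μ (ball x r) = μ (ball 0 r)) (hFc : ∀ᵐ z ∂μ, z ∈ F)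
    (c : ℝ) (hc : 0 < c) :
    ∃ (q : ι → ι → ℝ) (v : E),
      (∀ x, 0 ≤ ∑ i, ∑ j, (inner ℝ (b i) x * inner ℝ (b j) x) * q i j) ∧
      (∀ x, ∑ i, ∑ j, (inner ℝ (b i) x * inner ℝ (b j) x) * q i j ≤ tauf μ c * ‖x‖ ^ 2) ∧
      (∀ i j, q i j = q j i) ∧ (∑ i, q i i = tauf μ c) ∧
      (∑ i, ∑ j, q i j * q i j = tauf μ c) ∧
      ∀ x ∈ F, ‖x‖ ^ 2 = ∑ i, ∑ j, (inner ℝ (b i) x * inner ℝ (b j) x) * q i j + inner ℝ x v := by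
  have hck : ∀ k : ℕ, 0 < 4 ^ k * c := fun k => by positivity
  have hSk : ∀ k : ℕ, 0 < S2 μ (4 ^ k * c) := fun k => S2_pos μ h0 _ (hck k)
  have hS := S2_pos μ h0 c hc
  have hhalf : Filter.Tendsto (fun k : ℕ => (1 / 2 : ℝ) ^ k) Filter.atTop (nhds 0) :=
    tendsto_pow_atTop_nhds_zero_of_lt_one (by norm_num) (by norm_num)
  obtain ⟨V', CV, hV'b, hV'⟩ := bounded_proj (fun k => Vf μ (4 ^ k * c)) F (by
    intro x hx
    obtain ⟨K, hK⟩ := expansion_seq μ h0 hd x (hF x hx) c hc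
    refine ⟨|K| + ‖x‖ ^ 2 + tauf μ c * (‖x‖ * ‖x‖), fun k => ?_⟩
    have h1 := hK k
    have h2 := Bf_bound μ (4 ^ k * c) (hSk k) x x
    rw [tauf_scale μ hd] at h2
    have h3 : K * (1 / 2) ^ k ≤ |K| := by
      have : (1 / 2 : ℝ) ^ k ≤ 1 := pow_le_one₀ (by norm_num) (by norm_num)
      have h4 : (0 : ℝ) ≤ (1 / 2 : ℝ) ^ k := by positivity
      nlinarith [le_abs_self K, abs_nonneg K]
    rw [abs_le] at *
    have := sq_nonneg ‖x‖
    constructor <;> linarith [h1.1, h1.2, h2.1, h2.2])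
  -- compactness
  set w : ℕ → (ι → ι → ℝ) × E := fun k => (fun i j => Bf μ (4 ^ k * c) (b i) (b j), V' k) with hw
  have hwb : ∀ k, w k ∈ closedBall (0 : (ι → ι → ℝ) × E) (max |tauf μ c| |CV|) := by
    intro k
    rw [mem_closedBall, dist_zero_right, Prod.norm_def]
    apply max_le_max
    · rw [pi_norm_le_iff_of_nonneg (abs_nonneg _)]
      intro i
      rw [pi_norm_le_iff_of_nonneg (abs_nonneg _)]
      intro j
      have h2 := Bf_bound μ (4 ^ k * c) (hSk k) (b i) (b j)
      rw [tauf_scale μ hd, b.norm_eq_one, b.norm_eq_one] at h2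
      rw [Real.norm_eq_abs]
      refine h2.trans ?_
      rw [mul_one, mul_one]
      exact le_abs_self _
    · exact (hV'b k).trans (le_abs_self _)
  obtain ⟨⟨q, v⟩, -, φ, hφ, hlim⟩ := tendsto_subseq_of_bounded isBounded_closedBall hwb
  rw [Prod.tendsto_iff] at hlim
  obtain ⟨hq, hv⟩ := hlim
  have hqij : ∀ i j, Filter.Tendsto (fun n => Bf μ (4 ^ φ n * c) (b i) (b j)) Filter.atTop (nhds (q i j)) := by
    intro i j
    exact (tendsto_pi_nhds.1 (tendsto_pi_nhds.1 hq i) j)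
  have hv' : Filter.Tendsto (fun n => V' (φ n)) Filter.atTop (nhds v) := hv
  have hQ : ∀ x, Filter.Tendsto (fun n => Bf μ (4 ^ φ n * c) x x) Filter.atTop
      (nhds (∑ i, ∑ j, (inner ℝ (b i) x * inner ℝ (b j) x) * q i j)) := by
    intro x
    simp only [Bf_expand b μ _ x]
    exact tendsto_finsetSum _ fun i _ => tendsto_finsetSum _ fun j _ => (hqij i j).const_mul _
  have hx : ∀ x ∈ F, ‖x‖ ^ 2 = ∑ i, ∑ j, (inner ℝ (b i) x * inner ℝ (b j) x) * q i j + inner ℝ x v := by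
    intro x hx
    obtain ⟨K, hK⟩ := expansion_seq μ h0 hd x (hF x hx) c hc
    have hin : Filter.Tendsto (fun n => inner ℝ x (V' (φ n))) Filter.atTop (nhds (inner ℝ x v)) :=
      tendsto_const_nhds.inner hv'
    have hlim : Filter.Tendsto (fun n => ‖x‖ ^ 2 - inner ℝ x (V' (φ n)) - Bf μ (4 ^ φ n * c) x x)
        Filter.atTop (nhds (‖x‖ ^ 2 - inner ℝ x v - ∑ i, ∑ j, (inner ℝ (b i) x * inner ℝ (b j) x) * q i j)) :=
      (hin.const_sub _).sub (hQ x)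
    have hz : Filter.Tendsto (fun n => ‖x‖ ^ 2 - inner ℝ x (V' (φ n)) - Bf μ (4 ^ φ n * c) x x)
        Filter.atTop (nhds 0) := by
      apply squeeze_zero_norm (a := fun n => K * (1 / 2) ^ (φ n))
      · intro n
        rw [hV' x hx]
        exact hK (φ n)
      · simpa using (hhalf.comp hφ.tendsto_atTop).const_mul K
    have := tendsto_nhds_unique hlim hz
    linarith
  refine ⟨q, v, ?_, ?_, ?_, ?_, ?_, hx⟩
  · intro x
    exact ge_of_tendsto' (hQ x) fun n => Bf_diag_nonneg μ _ (hSk _) x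
  · intro x
    refine le_of_tendsto' (hQ x) fun n => ?_
    have h2 := Bf_bound μ (4 ^ φ n * c) (hSk _) x x
    rw [tauf_scale μ hd] at h2
    rw [sq]
    exact (le_abs_self _).trans h2
  · intro i j
    refine tendsto_nhds_unique (hqij i j) ?_
    simp only [Bf_symm μ _ (b i) (b j)]
    exact hqij j i
  · refine tendsto_nhds_unique (tendsto_finsetSum _ fun i _ => hqij i i) ?_
    simp only [Bf_trace, tauf_scale μ hd]
    exact tendsto_const_nhds
  · have hl : Filter.Tendsto (fun n => ∑ i, ∑ j, q i j * Bf μ (4 ^ φ n * c) (b i) (b j)) Filter.atTop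
        (nhds (∑ i, ∑ j, q i j * q i j)) :=
      tendsto_finsetSum _ fun i _ => tendsto_finsetSum _ fun j _ => (hqij i j).const_mul _
    have hid : ∀ k : ℕ, tauf μ c - ∑ i, ∑ j, q i j * Bf μ (4 ^ k * c) (b i) (b j)
        = 4 / S2 μ (4 ^ k * c) * ∫ z, ker (4 ^ k * c) z * inner ℝ z v ∂μ := by
      intro k
      rw [← int_quad, ← tauf_scale μ hd c k]
      unfold tauf
      rw [← int_ker_sq, ← mul_sub]
      congr 1
      rw [← integral_sub (integ_ker1 μ _ _ (by fun_prop)) (integ_ker1 μ _ _ (by fun_prop))]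
      apply integral_congr_ae
      filter_upwards [hFc] with z hz
      rw [hx z hz]
      simp only [mul_comm (q _ _)]
      ring
    have hz : Filter.Tendsto (fun n => tauf μ c - ∑ i, ∑ j, q i j * Bf μ (4 ^ φ n * c) (b i) (b j))
        Filter.atTop (nhds 0) := by
      apply squeeze_zero_norm (a := fun n => (4 / S2 μ c * (S1 μ c * (√c * ‖v‖))) * (1 / 2) ^ (φ n))
      · intro n
        rw [hid]
        have hS0 := hSk (φ n)
        have hb : ‖∫ z, ker (4 ^ φ n * c) z * inner ℝ z v ∂μ‖ ≤ S1 μ (4 ^ φ n * c) * (√(4 ^ φ n * c) * ‖v‖) := by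
          unfold S1
          rw [← integral_mul_const]
          apply norm_integral_le_of_norm_le ((integ_ker0 μ _).mul_const _)
          refine Filter.Eventually.of_forall fun z => ?_
          rw [norm_mul, Real.norm_eq_abs, abs_of_nonneg (ker_nonneg _ z), ← mul_assoc]
          calc _ ≤ ker (4 ^ φ n * c) z * (‖z‖ * ‖v‖) :=
                mul_le_mul_of_nonneg_left (abs_real_inner_le_norm z v) (ker_nonneg _ z)
            _ = ker (4 ^ φ n * c) z * ‖z‖ * ‖v‖ := by ring
            _ ≤ _ := mul_le_mul_of_nonneg_right (ker_mul_norm _ (hck _).le z) (norm_nonneg _)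
        rw [norm_mul, Real.norm_eq_abs (4 / _), abs_of_pos (by positivity)]
        refine (mul_le_mul_of_nonneg_left hb (by positivity)).trans (le_of_eq ?_)
        rw [S1_pow μ hd, S2_pow μ hd, sqrt_four_pow]
        have e32 : (32 : ℝ) ^ φ n = 8 ^ φ n * 2 ^ φ n * 2 ^ φ n := by rw [← mul_pow, ← mul_pow]; norm_num
        rw [e32, one_div, inv_pow]
        field_simp
      · simpa using (hhalf.comp hφ.tendsto_atTop).const_mul (4 / S2 μ c * (S1 μ c * (√c * ‖v‖)))
    have := tendsto_nhds_unique (hl.const_sub (tauf μ c)) hz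
    linarith
end main
section linearity
set_option linter.unusedSectionVars false
variable {E : Type*} [NormedAddCommGroup E] [InnerProductSpace ℝ E] [FiniteDimensional ℝ E]
  [MeasurableSpace E] [BorelSpace E]

theorem exists_far (μ : Measure E) [IsLocallyFiniteMeasure μ]
    (h0 : ∀ r : ℝ, 0 < r → 0 < μ (ball 0 r))
    (hd : ∀ r : ℝ, 0 < r → μ (ball 0 (2 * r)) = 2 * μ (ball 0 r))
    (F : Set E) (hFc : ∀ᵐ z ∂μ, z ∈ F) (r : ℝ) (hr : 0 < r) :
    ∃ z ∈ F, r ≤ ‖z‖ ∧ ‖z‖ < 2 * r := by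
  by_contra hcon
  push Not at hcon
  have h1 : μ (ball 0 (2 * r)) ≤ μ (ball (0 : E) r) := by
    apply measure_mono_ae
    filter_upwards [hFc] with z hz hzb
    change z ∈ ball 0 (2 * r) at hzb
    change z ∈ ball 0 r
    rw [mem_ball, dist_zero_right] at *
    by_contra h
    push Not at h
    exact absurd hzb (not_lt.2 (hcon z hz h))
  rw [hd r hr, two_mul] at h1
  have hfin : μ (ball (0 : E) r) ≠ ∞ := measure_ball_lt_top.ne
  exact absurd h1 (not_le.2 (ENNReal.lt_add_right hfin (h0 r hr).ne'))

theorem tauf_ge_one (μ : Measure E) [IsLocallyFiniteMeasure μ]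
    (h0 : ∀ r : ℝ, 0 < r → 0 < μ (ball 0 r))
    (hd : ∀ r : ℝ, 0 < r → μ (ball 0 (2 * r)) = 2 * μ (ball 0 r))
    (F : Set E) (hF : ∀ x ∈ F, ∀ r, μ (ball x r) = μ (ball 0 r)) (hFc : ∀ᵐ z ∂μ, z ∈ F)
    (c : ℝ) (hc : 0 < c) : 1 ≤ tauf μ c := by
  obtain ⟨q, v, -, hQ, -, -, -, hx⟩ := main_limit (stdOrthonormalBasis ℝ E) μ h0 hd F hF hFc c hc
  by_contra hcon
  push Not at hcon
  have hR : 0 < (‖v‖ + 1) / (1 - tauf μ c) := div_pos (by positivity) (by linarith)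
  obtain ⟨z, hz, hz1, -⟩ := exists_far μ h0 hd F hFc _ hR
  rw [div_le_iff₀ (by linarith)] at hz1
  have e1 := hx z hz
  have e2 := hQ z
  have e3 := real_inner_le_norm z v
  have hzp : 0 < ‖z‖ := by
    rcases (norm_nonneg z).eq_or_lt with h | h
    · rw [← h] at hz1
      have := norm_nonneg v
      linarith
    · exact h
  nlinarith

theorem hasDerivAt_of_quad (f : ℝ → ℝ) (f' x K δ : ℝ) (hδ : 0 < δ)
    (h : ∀ y, |y - x| < δ → |f y - f x - (y - x) * f'| ≤ K * (y - x) ^ 2) : HasDerivAt f f' x := by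
  rw [hasDerivAt_iff_isLittleO]
  refine Asymptotics.IsBigO.trans_isLittleO (g := fun y => ‖y - x‖ ^ 2) ?_
    (Asymptotics.isLittleO_pow_sub_sub x one_lt_two)
  apply Asymptotics.IsBigO.of_bound K
  filter_upwards [Metric.ball_mem_nhds x hδ] with y hy
  rw [mem_ball, Real.dist_eq] at hy
  have := h y hy
  rw [norm_pow, norm_norm, Real.norm_eq_abs, Real.norm_eq_abs, sq_abs, smul_eq_mul]
  exact this

theorem ker_diff (a b : ℝ) (z : E) : |ker b z ^ 2 - ker a z ^ 2 - (b - a) * (2 * ker a z)| ≤ (b - a) ^ 2 := by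
  unfold ker
  rw [abs_le]
  rcases le_total (a - ‖z‖ ^ 2) 0 with h | h <;> rcases le_total (b - ‖z‖ ^ 2) 0 with h' | h'
  · rw [max_eq_right h, max_eq_right h']; constructor <;> nlinarith [sq_nonneg (b - a)]
  · rw [max_eq_right h, max_eq_left h']; constructor <;> nlinarith
  · rw [max_eq_left h, max_eq_right h']; constructor <;> nlinarith
  · rw [max_eq_left h, max_eq_left h']; constructor <;> nlinarith

theorem S2_deriv (μ : Measure E) [IsLocallyFiniteMeasure μ] (c : ℝ) (hc : 0 < c) :
    HasDerivAt (S2 μ) (2 * S1 μ c) c := by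
  set R := √(c + 1) with hR
  apply hasDerivAt_of_quad _ _ _ (μ.real (closedBall (0 : E) R)) 1 one_pos
  intro y hy
  have hfin : μ (closedBall (0 : E) R) ≠ ∞ := (isCompact_closedBall (0 : E) R).measure_lt_top.ne
  have e : S2 μ y - S2 μ c - (y - c) * (2 * S1 μ c)
      = ∫ z, (ker y z ^ 2 - ker c z ^ 2 - (y - c) * (2 * ker c z)) ∂μ := by
    unfold S2 S1
    have hs : Integrable (fun z => ker y z ^ 2 - ker c z ^ 2) μ :=
      (integ_kerp μ y 2 two_ne_zero).sub (integ_kerp μ c 2 two_ne_zero)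
    rw [integral_sub hs
      (((integ_ker0 μ c).const_mul 2).const_mul _),
      integral_sub (integ_kerp μ y 2 two_ne_zero) (integ_kerp μ c 2 two_ne_zero),
      integral_const_mul, integral_const_mul]
  rw [e, ← Real.norm_eq_abs]
  have hIndInt : ∫ z, (closedBall (0 : E) R).indicator (fun _ => (y - c) ^ 2) z ∂μ
      = μ.real (closedBall (0 : E) R) * (y - c) ^ 2 := by
    rw [integral_indicator measurableSet_closedBall, setIntegral_const, smul_eq_mul]
  rw [← hIndInt]
  apply norm_integral_le_of_norm_le
  · rw [integrable_indicator_iff measurableSet_closedBall]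
    exact integrableOn_const hfin
  · refine Filter.Eventually.of_forall fun z => ?_
    by_cases hz : z ∈ closedBall (0 : E) R
    · rw [Set.indicator_of_mem hz, Real.norm_eq_abs]
      exact ker_diff c y z
    · rw [Set.indicator_of_notMem hz]
      rw [mem_closedBall, dist_zero_right, not_le] at hz
      have h1 : c + 1 ≤ ‖z‖ ^ 2 := (Real.sqrt_le_left (norm_nonneg z)).1 hz.le
      have h2 := (abs_lt.1 hy).2
      rw [ker_zero c z (by linarith), ker_zero y z (by linarith)]
      simp

theorem S1_diff (μ : Measure E) [IsLocallyFiniteMeasure μ] (r s : ℝ) (hr : 0 < r) (hrs : r < s) :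
    (s ^ 2 - r ^ 2) * μ.real (ball (0 : E) r) ≤ S1 μ (s ^ 2) - S1 μ (r ^ 2) ∧
    S1 μ (s ^ 2) - S1 μ (r ^ 2) ≤ (s ^ 2 - r ^ 2) * μ.real (ball (0 : E) s) := by
  have hsr : 0 ≤ s ^ 2 - r ^ 2 := by nlinarith
  have hind : ∀ t : ℝ, ∫ z, (ball (0 : E) t).indicator (fun _ => (s ^ 2 - r ^ 2)) z ∂μ
      = (s ^ 2 - r ^ 2) * μ.real (ball (0 : E) t) := by
    intro t
    rw [integral_indicator measurableSet_ball, setIntegral_const, smul_eq_mul, mul_comm]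
  have hii : ∀ t : ℝ, Integrable ((ball (0 : E) t).indicator (fun _ => (s ^ 2 - r ^ 2))) μ := by
    intro t
    rw [integrable_indicator_iff measurableSet_ball]
    exact integrableOn_const measure_ball_lt_top.ne
  have hk : Integrable (fun z => ker (s ^ 2) z - ker (r ^ 2) z) μ :=
    (integ_ker0 μ (s ^ 2)).sub (integ_ker0 μ (r ^ 2))
  have e : S1 μ (s ^ 2) - S1 μ (r ^ 2) = ∫ z, (ker (s ^ 2) z - ker (r ^ 2) z) ∂μ := by
    unfold S1
    rw [integral_sub (integ_ker0 μ (s ^ 2)) (integ_ker0 μ (r ^ 2))]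
  rw [e, ← hind, ← hind]
  constructor
  · apply integral_mono (hii r) hk
    intro z
    by_cases hz : z ∈ ball (0 : E) r
    · rw [Set.indicator_of_mem hz]
      rw [mem_ball, dist_zero_right] at hz
      have := norm_nonneg z
      unfold ker
      simp only
      rw [max_eq_left (a := s ^ 2 - _) (by nlinarith), max_eq_left (a := r ^ 2 - _) (by nlinarith)]
      linarith
    · rw [Set.indicator_of_notMem hz]
      unfold ker
      have : max (r ^ 2 - ‖z‖ ^ 2) 0 ≤ max (s ^ 2 - ‖z‖ ^ 2) 0 := max_le_max (by linarith) le_rfl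
      simp only
      linarith
  · apply integral_mono hk (hii s)
    intro z
    by_cases hz : z ∈ ball (0 : E) s
    · rw [Set.indicator_of_mem hz]
      rw [mem_ball, dist_zero_right] at hz
      have := norm_nonneg z
      unfold ker
      simp only
      rw [max_eq_left (a := s ^ 2 - _) (by nlinarith)]
      linarith [le_max_left (r ^ 2 - ‖z‖ ^ 2) 0]
    · rw [Set.indicator_of_notMem hz]
      rw [mem_ball, dist_zero_right, not_lt] at hz
      simp only
      rw [ker_zero (s ^ 2) z (by nlinarith)]
      linarith [ker_nonneg (r ^ 2) z]

theorem const_of_mono (f : ℝ → ℝ) (hm : MonotoneOn f (Set.Ioi 0))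
    (h2 : ∀ r, 0 < r → f (2 * r) = f r) : ∀ r, 0 < r → f r = f 1 := by
  have hp : ∀ r, 0 < r → ∀ n : ℕ, f (2 ^ n * r) = f r := by
    intro r hr n
    induction n with
    | zero => simp
    | succ n ih =>
      rw [show (2 : ℝ) ^ (n + 1) * r = 2 * (2 ^ n * r) by ring, h2 _ (by positivity), ih]
  have key : ∀ r s, 0 < r → r ≤ s → f r = f s := by
    intro r s hr hrs
    obtain ⟨n, hn⟩ := pow_unbounded_of_one_lt (s / r) (one_lt_two (α := ℝ))
    rw [div_lt_iff₀ hr] at hn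
    apply le_antisymm (hm hr (lt_of_lt_of_le hr hrs) hrs)
    rw [← hp r hr n]
    exact hm (lt_of_lt_of_le hr hrs) (by simp only [Set.mem_Ioi]; positivity) hn.le
  intro r hr
  rcases le_total r 1 with h | h
  · exact key r 1 hr h
  · exact (key 1 r one_pos h).symm

theorem g_linear (μ : Measure E) [IsLocallyFiniteMeasure μ]
    (h0 : ∀ r : ℝ, 0 < r → 0 < μ (ball 0 r))
    (hd : ∀ r : ℝ, 0 < r → μ (ball 0 (2 * r)) = 2 * μ (ball 0 r))
    (F : Set E) (hF : ∀ x ∈ F, ∀ r, μ (ball x r) = μ (ball 0 r)) (hFc : ∀ᵐ z ∂μ, z ∈ F) :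
    tauf μ 1 = 1 ∧ ∃ c0 : ℝ, 0 < c0 ∧ ∀ r, 0 < r → μ.real (ball (0 : E) r) = c0 * r := by
  set κ := S2 μ 1 with hκ
  have hκ0 : 0 < κ := S2_pos μ h0 1 one_pos
  have hder : ∀ r, 0 < r → HasDerivAt (fun r => S2 μ (r ^ 2)) (2 * S1 μ (r ^ 2) * (2 * r)) r := by
    intro r hr
    have h := (S2_deriv μ (r ^ 2) (by positivity))
    have h' : HasDerivAt (fun r : ℝ => r ^ 2) (2 * r) r := by simpa using hasDerivAt_pow 2 r
    exact HasDerivAt.comp (h₂ := S2 μ) (h := fun r : ℝ => r ^ 2) r h h'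
  have hder2 : ∀ r, 0 < r → HasDerivAt (fun r => S2 μ (r ^ 2) / r ^ 5)
      (((2 * S1 μ (r ^ 2) * (2 * r)) * r ^ 5 - S2 μ (r ^ 2) * (5 * r ^ 4)) / (r ^ 5) ^ 2) r := by
    intro r hr
    have h' : HasDerivAt (fun r : ℝ => r ^ 5) (5 * r ^ 4) r := by simpa using hasDerivAt_pow 5 r
    exact (hder r hr).div h' (by positivity)
  have hS12 : ∀ r, 0 < r → 5 * S2 μ (r ^ 2) ≤ 4 * (r ^ 2 * S1 μ (r ^ 2)) := by
    intro r hr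
    have h := tauf_ge_one μ h0 hd F hF hFc (r ^ 2) (by positivity)
    have hp := S2_pos μ h0 (r ^ 2) (by positivity)
    unfold tauf at h
    rw [div_mul_eq_mul_div, le_div_iff₀ hp] at h
    linarith
  have hmono : MonotoneOn (fun r => S2 μ (r ^ 2) / r ^ 5) (Set.Ioi 0) := by
    apply monotoneOn_of_deriv_nonneg (convex_Ioi 0)
    · intro r hr
      exact (hder2 r hr).continuousAt.continuousWithinAt
    · intro r hr
      rw [interior_Ioi] at hr
      exact (hder2 r hr).differentiableAt.differentiableWithinAt
    · intro r hr
      rw [interior_Ioi] at hr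
      have hr' : 0 < r := hr
      rw [(hder2 r hr).deriv]
      apply div_nonneg _ (by positivity)
      have h1 := hS12 r hr
      have h2 : 0 ≤ r ^ 4 := by positivity
      nlinarith
  have hconst := const_of_mono _ hmono (by
    intro r hr
    rw [show (2 * r) ^ 2 = 4 * r ^ 2 by ring, S2_scale μ hd, show (2 * r) ^ 5 = 32 * r ^ 5 by ring]
    field_simp)
  have hS2 : ∀ r, 0 < r → S2 μ (r ^ 2) = κ * r ^ 5 := by
    intro r hr
    have h := hconst r hr
    simp only [one_pow, div_one] at h
    rw [div_eq_iff (by positivity)] at h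
    exact h
  have hS1 : ∀ r, 0 < r → S1 μ (r ^ 2) = 5 / 4 * κ * r ^ 3 := by
    intro r hr
    have h1 := hder r hr
    have h2 : HasDerivAt (fun r : ℝ => κ * r ^ 5) (κ * (5 * r ^ 4)) r := by
      simpa using (hasDerivAt_pow 5 r).const_mul κ
    have h3 : (fun r => S2 μ (r ^ 2)) =ᶠ[nhds r] (fun r : ℝ => κ * r ^ 5) := by
      filter_upwards [Ioi_mem_nhds hr] with s hs
      exact hS2 s hs
    have h4 := (h2.congr_of_eventuallyEq h3).unique h1
    have : r * S1 μ (r ^ 2) = r * (5 / 4 * κ * r ^ 3) := by nlinarith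
    exact mul_left_cancel₀ hr.ne' this
  refine ⟨?_, 15 / 8 * κ, by positivity, ?_⟩
  · have h1 := hS1 1 one_pos
    simp only [one_pow, mul_one] at h1
    unfold tauf
    rw [h1, ← hκ]
    field_simp
    norm_num
  · intro r hr
    have hval : ∀ a b, 0 < a → a < b → S1 μ (b ^ 2) - S1 μ (a ^ 2)
        = (b ^ 2 - a ^ 2) * (5 / 4 * κ * ((b ^ 2 + a * b + a ^ 2) / (b + a))) := by
      intro a b ha hab
      rw [hS1 a ha, hS1 b (ha.trans hab)]
      have : b + a ≠ 0 := by linarith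
      field_simp
      ring
    have hcont : Filter.Tendsto (fun b : ℝ => 5 / 4 * κ * ((b ^ 2 + r * b + r ^ 2) / (b + r))) (nhds r)
        (nhds (15 / 8 * κ * r)) := by
      have : ContinuousAt (fun b : ℝ => 5 / 4 * κ * ((b ^ 2 + r * b + r ^ 2) / (b + r))) r := by
        apply ContinuousAt.mul (by fun_prop)
        apply ContinuousAt.div (by fun_prop) (by fun_prop)
        positivity
      have h := this.tendsto
      convert h using 2
      field_simp
      ring
    apply le_antisymm
    · refine ge_of_tendsto (hcont.mono_left (nhdsWithin_le_nhds (s := Set.Ioi r))) ?_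
      filter_upwards [self_mem_nhdsWithin] with b hb
      have h1 := (S1_diff μ r b hr hb).1
      rw [hval r b hr hb] at h1
      have hb' : r < b := hb
      exact le_of_mul_le_mul_left h1 (by nlinarith)
    · refine le_of_tendsto (hcont.mono_left (nhdsWithin_le_nhds (s := Set.Iio r))) ?_
      filter_upwards [self_mem_nhdsWithin, mem_nhdsWithin_of_mem_nhds (Ioi_mem_nhds hr)] with b hb hb0
      have hb' : b < r := hb
      have h1 := (S1_diff μ b r hb0 hb).2
      rw [hval b r hb0 hb] at h1
      have h2 := le_of_mul_le_mul_left h1 (by have : 0 < b := hb0; nlinarith)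
      convert h2 using 2
      ring
end linearity
theorem mat_rank_one {ι : Type*} [Fintype ι] (q : ι → ι → ℝ)
    (hpsd : ∀ a : ι → ℝ, 0 ≤ ∑ i, ∑ j, (a i * a j) * q i j) (hs : ∀ i j, q i j = q j i)
    (htr : ∑ i, q i i = 1) (hsq : ∑ i, ∑ j, q i j * q i j = 1) :
    ∃ e : ι → ℝ, ∑ i, e i ^ 2 = 1 ∧ ∀ i j, q i j = e i * e j := by
  classical
  set B : (ι → ℝ) → (ι → ℝ) → ℝ := fun a c => ∑ i, ∑ j, (a i * c j) * q i j with hB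
  have hBs : ∀ a c, B a c = B c a := by
    intro a c
    simp only [hB]
    rw [Finset.sum_comm]
    refine Finset.sum_congr rfl fun i _ => Finset.sum_congr rfl fun j _ => ?_
    rw [hs]; ring
  have hexp : ∀ a c t, B (fun i => a i + t * c i) (fun i => a i + t * c i)
      = B a a + 2 * t * B a c + t ^ 2 * B c c := by
    intro a c t
    have h1 : B (fun i => a i + t * c i) (fun i => a i + t * c i)
      = B a a + t * B a c + t * B c a + t ^ 2 * B c c := by
      simp only [hB, Finset.mul_sum, ← Finset.sum_add_distrib]
      refine Finset.sum_congr rfl fun i _ => Finset.sum_congr rfl fun j _ => ?_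
      ring
    rw [h1, hBs c a]; ring
  have hBi : ∀ a i, B a (Pi.single i 1) = ∑ j, a j * q j i := by
    intro a i
    simp only [hB]
    refine Finset.sum_congr rfl fun j _ => ?_
    simp [Pi.single_apply]
  have hBij : ∀ i j, B (Pi.single i 1) (Pi.single j 1) = q i j := by
    intro i j
    rw [hBi]
    simp [Pi.single_apply]
  have hle : ∀ i j, q i j * q i j ≤ q i i * q j j := by
    intro i j
    have h : ∀ t : ℝ, 0 ≤ q j j * (t * t) + 2 * q i j * t + q i i := by
      intro t
      have h1 := hpsd (fun k => (Pi.single i 1 : ι → ℝ) k + t * (Pi.single j 1 : ι → ℝ) k)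
      have h2 := hexp (Pi.single i 1) (Pi.single j 1) t
      simp only [hBij] at h2
      have h3 : 0 ≤ B (fun k => (Pi.single i 1 : ι → ℝ) k + t * (Pi.single j 1 : ι → ℝ) k)
        (fun k => (Pi.single i 1 : ι → ℝ) k + t * (Pi.single j 1 : ι → ℝ) k) := h1
      rw [h2] at h3
      linarith
    have := discrim_le_zero h
    unfold discrim at this
    nlinarith
  have hsum : ∑ i, ∑ j, (q i i * q j j - q i j * q i j) = 0 := by
    simp only [Finset.sum_sub_distrib]
    rw [hsq, ← Finset.sum_mul_sum, htr]
    norm_num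
  have heq : ∀ i j, q i j * q i j = q i i * q j j := by
    intro i j
    rw [Finset.sum_eq_zero_iff_of_nonneg
      (fun i _ => Finset.sum_nonneg fun j _ => sub_nonneg.2 (hle i j))] at hsum
    have h1 := hsum i (Finset.mem_univ i)
    rw [Finset.sum_eq_zero_iff_of_nonneg (fun j _ => sub_nonneg.2 (hle i j))] at h1
    have h2 := h1 j (Finset.mem_univ j)
    linarith
  have hpos : ∃ i, 0 < q i i := by
    by_contra hcon
    push Not at hcon
    have : ∑ i, q i i ≤ 0 := Finset.sum_nonpos fun i _ => hcon i
    linarith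
  obtain ⟨i, hi⟩ := hpos
  have hrow : ∑ j, q i j * q i j = q i i := by
    simp only [heq]
    rw [← Finset.mul_sum, htr, mul_one]
  set u : ι → ℝ := fun j => q i j with hu
  have huu : q i i ≤ B u u := by
    have h1 := hexp u (Pi.single i 1) (-1)
    have h3 : 0 ≤ B (fun k => u k + (-1) * (Pi.single i 1 : ι → ℝ) k)
        (fun k => u k + (-1) * (Pi.single i 1 : ι → ℝ) k) := hpsd _
    rw [h1, hBij, hBi] at h3
    have h4 : ∑ j, u j * q j i = q i i := by
      rw [← hrow]
      refine Finset.sum_congr rfl fun j _ => ?_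
      rw [hu, hs j i]
    rw [h4] at h3
    linarith
  have hss : √(q i i) * √(q i i) = q i i := Real.mul_self_sqrt hi.le
  have hs0 : 0 < √(q i i) := Real.sqrt_pos.2 hi
  have hzero : ∑ j, ∑ k, (q i i * q j k - u j * u k) ^ 2 = 0 := by
    apply le_antisymm
    · have h1 : ∑ j, ∑ k, (q i i * q j k - u j * u k) ^ 2
          = q i i ^ 2 * (∑ j, ∑ k, q j k * q j k) - 2 * q i i * B u u
            + (∑ j, u j * u j) * ∑ k, u k * u k := by
        rw [Finset.sum_mul_sum]
        simp only [hB, Finset.mul_sum, ← Finset.sum_add_distrib, ← Finset.sum_sub_distrib]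
        refine Finset.sum_congr rfl fun j _ => Finset.sum_congr rfl fun k _ => ?_
        ring
      rw [h1, hsq, hrow]
      nlinarith
    · exact Finset.sum_nonneg fun j _ => Finset.sum_nonneg fun k _ => sq_nonneg _
  refine ⟨fun j => u j / √(q i i), ?_, ?_⟩
  · have : ∀ j, (u j / √(q i i)) ^ 2 = (u j * u j) / q i i := by
      intro j
      rw [div_pow, Real.sq_sqrt hi.le, sq]
    simp only [this]
    rw [← Finset.sum_div, hrow, div_self hi.ne']
  · intro j k
    rw [Finset.sum_eq_zero_iff_of_nonneg
      (fun i _ => Finset.sum_nonneg fun j _ => sq_nonneg _)] at hzero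
    have h1 := hzero j (Finset.mem_univ j)
    rw [Finset.sum_eq_zero_iff_of_nonneg (fun j _ => sq_nonneg _)] at h1
    have h2 := pow_eq_zero_iff (two_ne_zero) |>.1 (h1 k (Finset.mem_univ k))
    rw [div_mul_div_comm, hss, eq_div_iff hi.ne']
    linarith

section cylinder
set_option linter.unusedSectionVars false
variable {E : Type*} [NormedAddCommGroup E] [InnerProductSpace ℝ E] [FiniteDimensional ℝ E]
  [MeasurableSpace E] [BorelSpace E]

theorem form_rank_one {ι : Type*} [Fintype ι] (b : OrthonormalBasis ι ℝ E) (q : ι → ι → ℝ)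
    (hpsd : ∀ x, 0 ≤ ∑ i, ∑ j, (inner ℝ (b i) x * inner ℝ (b j) x) * q i j)
    (hs : ∀ i j, q i j = q j i)
    (htr : ∑ i, q i i = 1) (hsq : ∑ i, ∑ j, q i j * q i j = 1) :
    ∃ e : E, ‖e‖ = 1 ∧
      ∀ x, ∑ i, ∑ j, (inner ℝ (b i) x * inner ℝ (b j) x) * q i j = inner ℝ e x ^ 2 := by
  have hcoord : ∀ (a : ι → ℝ) i, inner ℝ (b i) (b.repr.symm (WithLp.toLp 2 a)) = a i := by
    intro a i
    rw [← b.repr_apply_apply, LinearIsometryEquiv.apply_symm_apply]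
  obtain ⟨e, he1, he2⟩ := mat_rank_one q (by
    intro a
    have := hpsd (b.repr.symm (WithLp.toLp 2 a))
    simpa only [hcoord] using this) hs htr hsq
  refine ⟨b.repr.symm (WithLp.toLp 2 e), ?_, ?_⟩
  · have h := b.sum_sq_norm_inner_right (b.repr.symm (WithLp.toLp 2 e))
    simp only [hcoord, Real.norm_eq_abs, sq_abs] at h
    rw [he1] at h
    have h0 := norm_nonneg (b.repr.symm (WithLp.toLp 2 e))
    nlinarith
  · intro x
    rw [← b.sum_inner_mul_inner, sq, Finset.sum_mul_sum]
    refine Finset.sum_congr rfl fun j _ => Finset.sum_congr rfl fun k _ => ?_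
    rw [real_inner_comm (b j), real_inner_comm (b k) (b.repr.symm _), hcoord, hcoord, he2]
    ring

theorem cyl_aux (μ : Measure E) [IsLocallyFiniteMeasure μ]
    (h0 : ∀ r : ℝ, 0 < r → 0 < μ (ball 0 r))
    (hd : ∀ r : ℝ, 0 < r → μ (ball 0 (2 * r)) = 2 * μ (ball 0 r))
    (F : Set E) (hF : ∀ x ∈ F, ∀ r, μ (ball x r) = μ (ball 0 r)) (hFc : ∀ᵐ z ∂μ, z ∈ F)
    (c0 : ℝ) (hc0 : 0 < c0) (hg : ∀ r, 0 < r → μ.real (ball (0 : E) r) = c0 * r)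
    (e v : E) (he : ‖e‖ = 1) (hx : ∀ x ∈ F, ‖x‖ ^ 2 = inner ℝ e x ^ 2 + inner ℝ x v) :
    inner ℝ e v ≤ 0 := by
  by_contra hcon
  push Not at hcon
  set β := inner ℝ e v with hβ
  set y : E → E := fun x => x - inner ℝ e x • e with hy
  have hdec : ∀ x, x = inner ℝ e x • e + y x := fun x => by simp [hy]
  have hee : inner ℝ e e = 1 := by rw [real_inner_self_eq_norm_sq, he]; norm_num
  have hye : ∀ x, inner ℝ e (y x) = 0 := fun x => by
    simp [hy, inner_sub_right, real_inner_smul_right, he]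
  have hnorm : ∀ x, ‖x‖ ^ 2 = inner ℝ e x ^ 2 + ‖y x‖ ^ 2 := by
    intro x
    have : ‖y x‖ ^ 2 = ‖x‖ ^ 2 - inner ℝ e x ^ 2 := by
      simp only [hy]
      rw [norm_sub_sq_real, norm_smul, he, real_inner_smul_right, real_inner_comm, mul_one,
        Real.norm_eq_abs, sq_abs]
      ring
    linarith
  have hyy : ∀ x ∈ F, ‖y x‖ ^ 2 = inner ℝ x v := fun x h => by
    have h1 := hnorm x
    have h2 := hx x h
    linarith
  set C := ‖v‖ ^ 2 / (4 * β) with hC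
  have hC0 : 0 ≤ C := by positivity
  have hv0 := norm_nonneg v
  have hlow : ∀ x ∈ F, -C ≤ inner ℝ e x := by
    intro x h
    have h1 := hyy x h
    have h2 : inner ℝ x v = inner ℝ e x * β + inner ℝ (y x) v := by
      conv_lhs => rw [hdec x]
      rw [inner_add_left, real_inner_smul_left]
    have h3 := real_inner_le_norm (y x) v
    have h4 : C * (4 * β) = ‖v‖ ^ 2 := by rw [hC]; field_simp
    by_contra hcc
    push Not at hcc
    nlinarith [sq_nonneg (‖y x‖ - ‖v‖ / 2)]
  set K := C + 4 * ‖v‖ + 1 with hK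
  have hK0 : 0 < K := by positivity
  obtain ⟨x, hxF, hxK, -⟩ := exists_far μ h0 hd F hFc (K + 1) (by positivity)
  set ρ := ‖x‖ with hρ
  have hxv := real_inner_le_norm x v
  have hsx : ρ - ‖v‖ ≤ inner ℝ e x := by
    have h1 := hx x hxF
    have h2 := hlow x hxF
    by_contra hcc
    push Not at hcc
    nlinarith
  have hsx2 : inner ℝ e x ≤ ρ := by
    have := real_inner_le_norm e x
    rwa [he, one_mul] at this
  have hle : μ (ball (0 : E) (2 * ρ)) ≤ μ (ball x (ρ + K)) := by
    apply measure_mono_ae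
    filter_upwards [hFc] with z hz hzb
    change z ∈ ball 0 (2 * ρ) at hzb
    change z ∈ ball x (ρ + K)
    rw [mem_ball, dist_zero_right] at hzb
    rw [mem_ball, dist_eq_norm]
    have hsz1 := hlow z hz
    have hsz2 : inner ℝ e z ≤ 2 * ρ := by
      have := real_inner_le_norm e z
      rw [he, one_mul] at this
      linarith
    have h1 := hnorm (z - x)
    have h2 : inner ℝ e (z - x) = inner ℝ e z - inner ℝ e x := inner_sub_right _ _ _
    have h3 : y (z - x) = y z - y x := by
      simp only [hy, h2, sub_smul]; abel
    have h4 : ‖y z - y x‖ ^ 2 ≤ 2 * ‖y z‖ ^ 2 + 2 * ‖y x‖ ^ 2 := by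
      have := norm_sub_le (y z) (y x)
      have h5 := norm_nonneg (y z - y x)
      nlinarith [sq_nonneg (‖y z‖ - ‖y x‖)]
    have h5 := hyy z hz
    have h6 := hyy x hxF
    have h7 := real_inner_le_norm z v
    have h8 : ‖z‖ * ‖v‖ ≤ 2 * ρ * ‖v‖ := mul_le_mul_of_nonneg_right hzb.le hv0
    have h9 : (inner ℝ e z - inner ℝ e x) ^ 2 ≤ (ρ + C + ‖v‖) ^ 2 := by
      apply sq_le_sq'
      · linarith
      · linarith
    rw [h3, h2] at h1
    apply lt_of_pow_lt_pow_left₀ 2 (by linarith)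
    have h10 : (ρ + C + ‖v‖) ^ 2 + 6 * ρ * ‖v‖ < (ρ + K) ^ 2 := by
      rw [hK]
      have : 0 < ρ := by linarith
      have : 0 ≤ ρ * ‖v‖ := by positivity
      nlinarith [mul_nonneg hC0 hv0]
    linarith
  rw [hF x hxF] at hle
  have h1 := ENNReal.toReal_mono measure_ball_lt_top.ne hle
  rw [← measureReal_def, ← measureReal_def, hg _ (by linarith), hg _ (by linarith)] at h1
  have := le_of_mul_le_mul_left h1 hc0
  linarith

theorem cylinder (μ : Measure E) [IsLocallyFiniteMeasure μ]
    (h0 : ∀ r : ℝ, 0 < r → 0 < μ (ball 0 r))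
    (hd : ∀ r : ℝ, 0 < r → μ (ball 0 (2 * r)) = 2 * μ (ball 0 r))
    (F : Set E) (hF : ∀ x ∈ F, ∀ r, μ (ball x r) = μ (ball 0 r)) (hFc : ∀ᵐ z ∂μ, z ∈ F) :
    ∃ (c0 : ℝ) (e : E) (D : ℝ), 0 < c0 ∧ (∀ r, 0 < r → μ.real (ball (0 : E) r) = c0 * r) ∧
      ‖e‖ = 1 ∧ 0 ≤ D ∧ ∀ x ∈ F, ‖x‖ ^ 2 ≤ inner ℝ e x ^ 2 + D ^ 2 ∧
        ‖x - inner ℝ e x • e‖ ≤ D := by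
  obtain ⟨ht, c0, hc0, hg⟩ := g_linear μ h0 hd F hF hFc
  obtain ⟨q, v, hpsd, -, hs, htr, hsq, hx⟩ :=
    main_limit (stdOrthonormalBasis ℝ E) μ h0 hd F hF hFc 1 one_pos
  rw [ht] at htr hsq
  obtain ⟨e, he, hQ⟩ := form_rank_one _ q hpsd hs htr hsq
  simp only [hQ] at hx
  have h1 := cyl_aux μ h0 hd F hF hFc c0 hc0 hg e v he hx
  have h2 := cyl_aux μ h0 hd F hF hFc c0 hc0 hg (-e) v (by rwa [norm_neg]) (by
    intro x h
    rw [inner_neg_left, neg_sq]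
    exact hx x h)
  rw [inner_neg_left] at h2
  have hev : inner ℝ e v = 0 := by linarith
  refine ⟨c0, e, ‖v‖, hc0, hg, he, norm_nonneg v, fun x hxF => ?_⟩
  have hn : ‖x - inner ℝ e x • e‖ ^ 2 = ‖x‖ ^ 2 - inner ℝ e x ^ 2 := by
    rw [norm_sub_sq_real, norm_smul, he, real_inner_smul_right, real_inner_comm, mul_one,
      Real.norm_eq_abs, sq_abs]
    ring
  have h3 := hx x hxF
  have h4 : inner ℝ x v = inner ℝ (x - inner ℝ e x • e) v := by
    rw [inner_sub_left, real_inner_smul_left, hev]; ring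
  have h5 := real_inner_le_norm (x - inner ℝ e x • e) v
  have h6 := norm_nonneg (x - inner ℝ e x • e)
  have h7 := norm_nonneg v
  have h8 : ‖x - inner ℝ e x • e‖ ≤ ‖v‖ := by
    by_contra hcc
    push Not at hcc
    nlinarith
  refine ⟨?_, h8⟩
  nlinarith
end cylinder
section line
set_option linter.unusedSectionVars false
variable {E : Type*} [NormedAddCommGroup E] [InnerProductSpace ℝ E] [FiniteDimensional ℝ E]
  [MeasurableSpace E] [BorelSpace E]

theorem eq_lebesgue_of_bounds (ν : Measure ℝ) (hfin : ∀ a b, ν (Set.Ico a b) ≠ ∞)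
    (P : Set ℝ) (hne : P.Nonempty) (c C : ℝ) (hc : 0 < c) (hC : 0 ≤ C)
    (hmeet : ∀ a b, a < b → 0 < ν (Set.Ico a b) → ∃ s ∈ P, a ≤ s ∧ s < b)
    (hlow : ∀ s ∈ P, ∀ ρ, 0 < ρ → c * ρ ≤ ν.real (Set.Ico (s - ρ) (s + ρ)))
    (hup : ∀ s ∈ P, ∀ ρ, 0 < ρ → ν.real (Set.Ico (s - ρ) (s + ρ)) ≤ c * ρ + C / ρ) :
    (∀ a b, a ≤ b → ν.real (Set.Ico a b) = c / 2 * (b - a)) ∧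
    ν = ENNReal.ofReal (c / 2) • volume := by
  have hadd : ∀ a b d, a ≤ b → b ≤ d →
      ν.real (Set.Ico a d) = ν.real (Set.Ico a b) + ν.real (Set.Ico b d) := by
    intro a b d hab hbd
    rw [← Set.Ico_union_Ico_eq_Ico hab hbd]
    exact measureReal_union (Set.Ico_disjoint_Ico_same) measurableSet_Ico (hfin a b) (hfin b d)
  set N : ℝ → ℝ := fun t => ν.real (Set.Ico 0 t) - ν.real (Set.Ico t 0) with hN
  have hz : ∀ a b : ℝ, b ≤ a → ν.real (Set.Ico a b) = 0 := by
    intro a b h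
    rw [Set.Ico_eq_empty (not_lt.2 h), measureReal_empty]
  have hNd : ∀ a b, a ≤ b → N b - N a = ν.real (Set.Ico a b) := by
    intro a b hab
    simp only [hN]
    rcases le_total 0 a with ha | ha
    · rw [hz b 0 (ha.trans hab), hz a 0 ha, hadd 0 a b ha hab]; ring
    · rcases le_total 0 b with hb | hb
      · rw [hz b 0 hb, hz 0 a ha, hadd a 0 b ha hb]; ring
      · rw [hz 0 b hb, hz 0 a ha, hadd a b 0 hab hb]; ring
  have hcore := oneD_core N (by
      intro a b hab
      have := hNd a b hab
      have h2 : 0 ≤ ν.real (Set.Ico a b) := measureReal_nonneg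
      linarith) P hne c C hc hC (by
      intro a b hab hlt
      apply hmeet a b hab
      have h1 := hNd a b hab.le
      have h2 : 0 < ν.real (Set.Ico a b) := by linarith
      exact (ENNReal.toReal_pos_iff.1 h2).1) (by
      intro s hs ρ hρ
      rw [hNd _ _ (by linarith)]
      exact hlow s hs ρ hρ) (by
      intro s hs ρ hρ
      rw [hNd _ _ (by linarith)]
      exact hup s hs ρ hρ)
  have hreal : ∀ a b, a ≤ b → ν.real (Set.Ico a b) = c / 2 * (b - a) := by
    intro a b hab
    rw [← hNd a b hab, hcore]
  refine ⟨hreal, ?_⟩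
  symm
  have : IsLocallyFiniteMeasure (ENNReal.ofReal (c / 2) • (volume : Measure ℝ)) :=
    inferInstanceAs (IsLocallyFiniteMeasure ((c / 2).toNNReal • (volume : Measure ℝ)))
  apply Measure.ext_of_Ico
  intro a b hab
  rw [Measure.smul_apply, Real.volume_Ico, smul_eq_mul, ← ENNReal.ofReal_mul (by positivity),
    ← hreal a b hab.le, ofReal_measureReal (hfin a b)]

theorem line_measure (μ : Measure E) [IsLocallyFiniteMeasure μ]
    (h0 : ∀ r : ℝ, 0 < r → 0 < μ (ball 0 r))
    (hd : ∀ r : ℝ, 0 < r → μ (ball 0 (2 * r)) = 2 * μ (ball 0 r))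
    (F : Set E) (hF : ∀ x ∈ F, ∀ r, μ (ball x r) = μ (ball 0 r)) (hFc : ∀ᵐ z ∂μ, z ∈ F) :
    ∃ (c : ℝ) (e : E), 0 < c ∧ ‖e‖ = 1 ∧
      μ = ENNReal.ofReal c • (volume : Measure ℝ).map (fun s : ℝ => s • e) := by
  obtain ⟨c0, e, D, hc0, hg, he, hD, hcyl⟩ := cylinder μ h0 hd F hF hFc
  have hgx : ∀ x ∈ F, ∀ r, 0 < r → μ.real (ball x r) = c0 * r := by
    intro x hx r hr
    rw [← hg r hr, measureReal_def, measureReal_def, hF x hx]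
  have hπm : Measurable (fun z : E => inner ℝ e z) := by fun_prop
  set ν := μ.map (fun z : E => inner ℝ e z) with hν
  have hνI : ∀ a b, ν (Set.Ico a b) = μ {z | a ≤ inner ℝ e z ∧ inner ℝ e z < b} := by
    intro a b
    rw [hν, Measure.map_apply hπm measurableSet_Ico]
    rfl
  have hpi : ∀ z : E, |inner ℝ e z| ≤ ‖z‖ := by
    intro z
    have := abs_real_inner_le_norm e z
    rwa [he, one_mul] at this
  have hn : ∀ x : E, ‖x - inner ℝ e x • e‖ ^ 2 = ‖x‖ ^ 2 - inner ℝ e x ^ 2 := by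
    intro x
    rw [norm_sub_sq_real, norm_smul, he, real_inner_smul_right, real_inner_comm, mul_one,
      Real.norm_eq_abs, sq_abs]
    ring
  have hfin : ∀ a b, ν (Set.Ico a b) ≠ ∞ := by
    intro a b
    rw [hνI]
    have : μ {z | a ≤ inner ℝ e z ∧ inner ℝ e z < b} ≤ μ (ball 0 (|a| + |b| + D + 1)) := by
      apply measure_mono_ae
      filter_upwards [hFc] with z hz hzb
      change a ≤ inner ℝ e z ∧ inner ℝ e z < b at hzb
      change z ∈ ball 0 (|a| + |b| + D + 1)
      rw [mem_ball, dist_zero_right]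
      have h1 := (hcyl z hz).1
      have h2 : |inner ℝ e z| ≤ |a| + |b| := by
        rw [abs_le]
        have := neg_abs_le a
        have := le_abs_self b
        have := abs_nonneg a
        have := abs_nonneg b
        constructor <;> linarith
      have h3 := abs_nonneg (inner ℝ e z)
      rw [← sq_abs (inner ℝ e z)] at h1
      apply lt_of_pow_lt_pow_left₀ 2 (by positivity)
      nlinarith
    exact (this.trans_lt measure_ball_lt_top).ne
  obtain ⟨hreal, hleb⟩ := eq_lebesgue_of_bounds ν hfin ((fun z : E => inner ℝ e z) '' F) (by
      obtain ⟨z, hz, -⟩ := exists_far μ h0 hd F hFc 1 one_pos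
      exact ⟨_, z, hz, rfl⟩) c0 (c0 * (2 * D + 1) ^ 2 / 2) hc0 (by positivity) (by
      intro a b hab hpos
      by_contra hcon
      push Not at hcon
      rw [hνI] at hpos
      apply hpos.ne'
      have : ∀ᵐ z ∂μ, ¬ (a ≤ inner ℝ e z ∧ inner ℝ e z < b) := by
        filter_upwards [hFc] with z hz h
        exact absurd h.2 (not_lt.2 (hcon _ ⟨z, hz, rfl⟩ h.1))
      rw [ae_iff] at this
      simpa using this) (by
      rintro s ⟨x, hx, rfl⟩ ρ hρ
      rw [← hgx x hx ρ hρ, measureReal_def, measureReal_def]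
      apply ENNReal.toReal_mono (hfin _ _)
      rw [hνI]
      apply measure_mono
      intro z hz
      rw [mem_ball, dist_eq_norm] at hz
      have h1 := hpi (z - x)
      rw [inner_sub_right, abs_le] at h1
      simp only [Set.mem_ofPred_eq]
      constructor <;> linarith [h1.1, h1.2]) (by
      rintro s ⟨x, hx, rfl⟩ ρ hρ
      set T := √(ρ ^ 2 + (2 * D + 1) ^ 2) with hT
      have hT0 : 0 < T := Real.sqrt_pos.2 (by positivity)
      have hT2 : T ^ 2 = ρ ^ 2 + (2 * D + 1) ^ 2 := Real.sq_sqrt (by positivity)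
      have h1 : ν.real (Set.Ico (inner ℝ e x - ρ) (inner ℝ e x + ρ)) ≤ μ.real (ball x T) := by
        rw [measureReal_def, measureReal_def]
        apply ENNReal.toReal_mono measure_ball_lt_top.ne
        rw [hνI]
        apply measure_mono_ae
        filter_upwards [hFc] with z hz hzb
        change inner ℝ e x - ρ ≤ inner ℝ e z ∧ inner ℝ e z < inner ℝ e x + ρ at hzb
        change z ∈ ball x T
        rw [mem_ball, dist_eq_norm]
        apply lt_of_pow_lt_pow_left₀ 2 hT0.le
        rw [hT2]
        have h2 := hn (z - x)
        have h3 : z - x - inner ℝ e (z - x) • e = (z - inner ℝ e z • e) - (x - inner ℝ e x • e) := by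
          rw [inner_sub_right, sub_smul]; abel
        have h4 := norm_sub_le (z - inner ℝ e z • e) (x - inner ℝ e x • e)
        rw [← h3] at h4
        have h5 := (hcyl z hz).2
        have h6 := (hcyl x hx).2
        have h7 : ‖z - x - inner ℝ e (z - x) • e‖ ^ 2 ≤ (2 * D) ^ 2 :=
          pow_le_pow_left₀ (norm_nonneg _) (by linarith) 2
        have h8 : inner ℝ e (z - x) ^ 2 ≤ ρ ^ 2 := by
          rw [inner_sub_right]
          apply sq_le_sq' <;> linarith [hzb.1, hzb.2]
        nlinarith
      rw [hgx x hx T hT0] at h1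
      have h2 : T ≤ ρ + (2 * D + 1) ^ 2 / 2 / ρ := by
        rw [← pow_le_pow_iff_left₀ hT0.le (by positivity) two_ne_zero]
        rw [hT2]
        have : (ρ + (2 * D + 1) ^ 2 / 2 / ρ) ^ 2
            = ρ ^ 2 + (2 * D + 1) ^ 2 + ((2 * D + 1) ^ 2 / 2 / ρ) ^ 2 := by
          field_simp; ring
        rw [this]
        have := sq_nonneg ((2 * D + 1) ^ 2 / 2 / ρ)
        linarith
      calc _ ≤ c0 * T := h1
        _ ≤ c0 * (ρ + (2 * D + 1) ^ 2 / 2 / ρ) := mul_le_mul_of_nonneg_left h2 hc0.le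
        _ = _ := by ring)
  have hline : ∀ z ∈ F, inner ℝ e z • e = z := by
    intro z hz
    have hle : ‖z‖ ≤ |inner ℝ e z| := by
      by_contra hcon
      push Not at hcon
      set ρ := (|inner ℝ e z| + ‖z‖) / 2 with hρ
      set ε := (‖z‖ - |inner ℝ e z|) / 2 with hε
      have hε0 : 0 < ε := by rw [hε]; linarith
      have hρ0 : 0 < ρ := by rw [hρ]; linarith [abs_nonneg (inner ℝ e z)]
      have hdisj : Disjoint (ball (0 : E) ρ) (ball z ε) := by
        rw [Set.disjoint_left]
        intro w h1 h2
        rw [mem_ball, dist_zero_right] at h1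
        rw [mem_ball, dist_eq_norm] at h2
        have := norm_sub_norm_le z w
        rw [norm_sub_rev] at this
        linarith
      have h1 : μ.real (ball (0 : E) ρ ∪ ball z ε) ≤ ν.real (Set.Ico (-ρ) ρ) := by
        rw [measureReal_def, measureReal_def]
        apply ENNReal.toReal_mono (hfin _ _)
        rw [hνI]
        apply measure_mono
        intro w hw
        have : |inner ℝ e w| < ρ := by
          rcases hw with hw | hw
          · rw [mem_ball, dist_zero_right] at hw
            exact (hpi w).trans_lt hw
          · rw [mem_ball, dist_eq_norm] at hw
            have h1 := hpi (w - z)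
            rw [inner_sub_right] at h1
            have h2 := abs_sub_abs_le_abs_sub (inner ℝ e w) (inner ℝ e z)
            linarith
        rw [abs_lt] at this
        exact ⟨this.1.le, this.2⟩
      rw [measureReal_union hdisj measurableSet_ball measure_ball_lt_top.ne measure_ball_lt_top.ne,
        hg ρ hρ0, hgx z hz ε hε0, hreal _ _ (by linarith)] at h1
      have := mul_pos hc0 hε0
      linarith
    have h2 := hn z
    have h3 : ‖z‖ ^ 2 ≤ inner ℝ e z ^ 2 := by
      rw [← sq_abs (inner ℝ e z)]
      exact pow_le_pow_left₀ (norm_nonneg z) hle 2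
    have h4 : ‖z - inner ℝ e z • e‖ = 0 := by
      have := norm_nonneg (z - inner ℝ e z • e)
      nlinarith
    rw [norm_eq_zero, sub_eq_zero] at h4
    exact h4.symm
  refine ⟨c0 / 2, e, by positivity, he, ?_⟩
  have h1 : μ.map (fun z : E => inner ℝ e z • e) = μ := by
    conv_rhs => rw [← Measure.map_id (μ := μ)]
    apply Measure.map_congr
    filter_upwards [hFc] with z hz
    exact hline z hz
  have h2 : ν.map (fun s : ℝ => s • e) = μ := by
    rw [hν, Measure.map_map (by fun_prop) hπm]
    exact h1
  rw [← Measure.map_smul, ← hleb, h2]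
end line
section final
set_option linter.unusedSectionVars false

theorem isometry_line {d : ℕ} (p e : EuclideanSpace ℝ (Fin d)) (he : ‖e‖ = 1) :
    Isometry (fun s : ℝ => p + s • e) := by
  apply Isometry.of_dist_eq
  intro s t
  rw [dist_add_left, dist_eq_norm, ← sub_smul, norm_smul, he, mul_one, Real.dist_eq,
    Real.norm_eq_abs]

theorem hausdorff_line {d : ℕ} (p e : EuclideanSpace ℝ (Fin d)) (he : ‖e‖ = 1) :
    (μH[1] : Measure (EuclideanSpace ℝ (Fin d))).restrict (Set.range (fun s : ℝ => p + s • e))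
      = (volume : Measure ℝ).map (fun s : ℝ => p + s • e) := by
  rw [← hausdorffMeasure_real, (isometry_line p e he).map_hausdorffMeasure (Or.inl zero_le_one)]

theorem line_delta {d : ℕ} (c : ℝ) (p e : EuclideanSpace ℝ (Fin d)) (he : ‖e‖ = 1)
    (μ : Measure (EuclideanSpace ℝ (Fin d)))
    (hμ : μ = ENNReal.ofReal c • (volume : Measure ℝ).map (fun s : ℝ => p + s • e))
    (x : EuclideanSpace ℝ (Fin d)) (hx : x ∈ msupport μ) (r : ℝ) (hr : 0 < r) :
    ballDelta μ x r = 0 := by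
  have hf := isometry_line p e he
  have hball : ∀ y r, μ (ball y r)
      = ENNReal.ofReal c * volume ((fun s : ℝ => p + s • e) ⁻¹' ball y r) := by
    intro y r
    rw [hμ, Measure.smul_apply, Measure.map_apply hf.continuous.measurable measurableSet_ball,
      smul_eq_mul]
  have hmem : x ∈ Set.range (fun s : ℝ => p + s • e) := by
    by_contra hcon
    have hcl : IsClosed (Set.range (fun s : ℝ => p + s • e)) := hf.isClosedEmbedding.isClosed_range
    obtain ⟨ε, hε, hsub⟩ := Metric.isOpen_iff.1 hcl.isOpen_compl x hcon
    have h1 := hx ε hε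
    rw [hball] at h1
    have h2 : (fun s : ℝ => p + s • e) ⁻¹' ball x ε = ∅ := by
      rw [Set.eq_empty_iff_forall_notMem]
      intro s hs
      exact hsub hs ⟨s, rfl⟩
    rw [h2] at h1
    simp at h1
  obtain ⟨t, rfl⟩ := hmem
  have hval : ∀ r, 0 < r → (μ (ball (p + t • e) r)).toReal = (ENNReal.ofReal c).toReal * (2 * r) := by
    intro r hr
    rw [hball, hf.preimage_ball t r, Real.volume_ball, ENNReal.toReal_mul,
      ENNReal.toReal_ofReal (show 0 ≤ 2 * r by positivity)]
  unfold ballDelta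
  simp only
  rw [hval r hr, hval (2 * r) (by positivity), abs_eq_zero]
  field_simp
  ring

theorem exists_line {d : ℕ} (μ : Measure (EuclideanSpace ℝ (Fin d)))
    [IsLocallyFiniteMeasure μ] (hne : μ ≠ 0)
    (h : ∀ x ∈ msupport μ, ∀ r : ℝ, 0 < r → ballDelta μ x r = 0) :
    ∃ (c : ℝ) (p e : EuclideanSpace ℝ (Fin d)), 0 < c ∧ ‖e‖ = 1 ∧
      μ = ENNReal.ofReal c • (volume : Measure ℝ).map (fun s : ℝ => p + s • e) := by
  have hsupp : μ.support = msupport μ := by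
    ext x
    exact nhds_basis_ball.mem_measureSupport
  obtain ⟨p, hp⟩ := Measure.nonempty_support hne
  have hae : ∀ᵐ z ∂μ, z ∈ msupport μ := by
    rw [← hsupp]; exact Measure.support_mem_ae
  rw [hsupp] at hp
  have hdbl : ∀ x ∈ msupport μ, ∀ r : ℝ, 0 < r → μ (ball x (2 * r)) = 2 * μ (ball x r) := by
    intro x hx r hr
    have h1 := h x hx r hr
    unfold ballDelta at h1
    rw [abs_eq_zero, sub_eq_zero, div_eq_div_iff hr.ne' (by positivity)] at h1
    have h2 : (μ (ball x (2 * r))).toReal = (2 * μ (ball x r)).toReal := by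
      rw [ENNReal.toReal_mul, ENNReal.toReal_ofNat]
      apply mul_right_cancel₀ hr.ne'
      linarith
    rwa [ENNReal.toReal_eq_toReal_iff' measure_ball_lt_top.ne
      (ENNReal.mul_ne_top (by norm_num) measure_ball_lt_top.ne)] at h2
  have huni : ∀ x ∈ msupport μ, ∀ r, μ (ball x r) = μ (ball p r) := fun x hx r =>
    le_antisymm (ball_uniform μ x p (hdbl x hx) (hdbl p hp) r)
      (ball_uniform μ p x (hdbl p hp) (hdbl x hx) r)
  have hm : Measurable (fun z : EuclideanSpace ℝ (Fin d) => z - p) := by fun_prop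
  set μ' := μ.map (fun z => z - p) with hμ'
  have hb' : ∀ y r, μ' (ball y r) = μ (ball (y + p) r) := by
    intro y r
    rw [hμ', Measure.map_apply hm measurableSet_ball]
    congr 1
    ext z
    simp only [Set.mem_preimage, mem_ball, dist_eq_norm]
    rw [sub_sub, add_comm p y]
  have : IsLocallyFiniteMeasure μ' := ⟨fun y => ⟨ball y 1, ball_mem_nhds y one_pos, by
    rw [hb']; exact measure_ball_lt_top⟩⟩
  obtain ⟨c, e, hc, he, hμe⟩ := line_measure μ'
    (by intro r hr; rw [hb', zero_add]; exact hp r hr)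
    (by intro r hr; rw [hb', hb', zero_add]; exact hdbl p hp r hr)
    {z | z + p ∈ msupport μ}
    (by intro x hx r; rw [hb', hb', zero_add]; exact huni _ hx r)
    (by
      have hmeas : MeasurableSet {z : EuclideanSpace ℝ (Fin d) | z + p ∈ msupport μ} := by
        have : MeasurableSet (msupport μ) := by
          rw [← hsupp]; exact Measure.isClosed_support.measurableSet
        exact (measurable_add_const p) this
      rw [hμ']
      refine (ae_map_iff hm.aemeasurable hmeas).2 ?_
      filter_upwards [hae] with z hz
      simpa using hz)
  refine ⟨c, p, e, hc, he, ?_⟩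
  have h1 : μ'.map (fun z => p + z) = μ := by
    rw [hμ', Measure.map_map (by fun_prop) hm]
    have : (fun z => p + z) ∘ (fun z => z - p) = (id : EuclideanSpace ℝ (Fin d) → _) := by
      funext z; simp
    rw [this, Measure.map_id]
  rw [← h1, hμe, Measure.map_smul, Measure.map_map (by fun_prop) (by fun_prop)]
  rfl
end final

theorem stmt7 {d : ℕ} (μ : Measure (EuclideanSpace ℝ (Fin d)))
    [IsLocallyFiniteMeasure μ] (hne : μ ≠ 0) :
    (∃ c : ℝ, 0 < c ∧ ∃ L : Set (EuclideanSpace ℝ (Fin d)), IsLine L ∧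
        μ = (ENNReal.ofReal c) • (μH[1].restrict L)) ↔
      ∀ x ∈ msupport μ, ∀ r : ℝ, 0 < r → ballDelta μ x r = 0 := by
  constructor
  · rintro ⟨c, hc, L, ⟨p, v, hv, hL⟩, hμ⟩ x hx r hr
    have hv0 : ‖v‖ ≠ 0 := norm_ne_zero_iff.2 hv
    have he : ‖‖v‖⁻¹ • v‖ = 1 := by
      rw [norm_smul, norm_inv, norm_norm, inv_mul_cancel₀ hv0]
    have hLr : L = Set.range (fun s : ℝ => p + s • (‖v‖⁻¹ • v)) := by
      rw [hL]
      ext y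
      constructor
      · rintro ⟨t, rfl⟩
        refine ⟨t * ‖v‖, ?_⟩
        simp only
        rw [smul_smul, mul_assoc, mul_inv_cancel₀ hv0, mul_one]
      · rintro ⟨t, rfl⟩
        refine ⟨t * ‖v‖⁻¹, ?_⟩
        simp only
        rw [smul_smul]
    rw [hLr, hausdorff_line p _ he] at hμ
    exact line_delta c p _ he μ hμ x hx r hr
  · intro h
    obtain ⟨c, p, e, hc, he, hμ⟩ := exists_line μ hne h
    refine ⟨c, hc, Set.range (fun s : ℝ => p + s • e), ⟨p, e, ?_, ?_⟩, ?_⟩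
    · rw [← norm_ne_zero_iff, he]; exact one_ne_zero
    · ext y
      constructor
      · rintro ⟨t, rfl⟩
        exact ⟨t, rfl⟩
      · rintro ⟨t, rfl⟩
        exact ⟨t, rfl⟩
    · rw [hausdorff_line p e he]
      exact hμ
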